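/- arXiv:1711.10743 — 12 statements merged into one kernel-verified Lean document; each statement's English description precedes it below -/
import Mathlib

section
/- Let f : ℝ² → ℝ be given by f(x,y) = (1/2)(x²+y²) + (1/24)(a₄₀x⁴ + 4a₃₁x³y + 6a₂₂x²y² + 4a₁₃xy³ + a₀₄y⁴) + R(x,y), where a₄₀, a₃₁, a₂₂, a₁₃, a₀₄ are real numbers and R : ℝ² → ℝ is smooth with all partial derivatives of order ≤ 4 vanishing at the origin. Set a = a₄₀ − 3a₂₂, b = a₃₁ − 3a₁₃, c = a₁₃ − 3a₃₁, d = a₀₄ − 3a₂₂. Then, as (x,y) → (0,0), F₁₁₁(f)(x,y) − (1/4)(ax + by) = O(‖(x,y)‖²) and F₂₂₂(f)(x,y) − (1/4)(cx + dy) = O(‖(x,y)‖²). -/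
open Topology Asymptotics

/-- Partial derivative in the first variable. -/
noncomputable def pdx (f : ℝ → ℝ → ℝ) : ℝ → ℝ → ℝ := fun x y => deriv (fun x' => f x' y) x

/-- Partial derivative in the second variable. -/
noncomputable def pdy (f : ℝ → ℝ → ℝ) : ℝ → ℝ → ℝ := fun x y => deriv (fun y' => f x y') y

/-- φ⁵·C₁₁₁ component of the affine cubic form of the graph of `f`. -/
noncomputable def F111 (f : ℝ → ℝ → ℝ) (x y : ℝ) : ℝ :=
  (1/4) * pdx (pdx (pdx f)) x y * pdx (pdx f) x y * pdy (pdy f) x y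
  - (3/4) * pdy (pdy (pdx f)) x y * (pdx (pdx f) x y)^2
  + (3/2) * pdy (pdx (pdx f)) x y * pdx (pdx f) x y * pdy (pdx f) x y
  - pdx (pdx (pdx f)) x y * (pdy (pdx f) x y)^2

/-- φ⁵·C₂₂₂ component of the affine cubic form of the graph of `f`. -/
noncomputable def F222 (f : ℝ → ℝ → ℝ) (x y : ℝ) : ℝ :=
  (1/4) * pdy (pdy (pdy f)) x y * pdx (pdx f) x y * pdy (pdy f) x y
  - (3/4) * pdy (pdx (pdx f)) x y * (pdy (pdy f) x y)^2
  + (3/2) * pdy (pdy (pdx f)) x y * pdy (pdy f) x y * pdy (pdx f) x y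
  - pdy (pdy (pdy f)) x y * (pdy (pdx f) x y)^2

/-- `g` is smooth and its derivatives of order at most `n` vanish at the origin. -/
def FlatToOrder (n : ℕ) (g : ℝ → ℝ → ℝ) : Prop :=
  ContDiff ℝ (⊤ : ℕ∞) (fun p : ℝ × ℝ => g p.1 p.2) ∧
    ∀ k ≤ n, iteratedFDeriv ℝ k (fun p : ℝ × ℝ => g p.1 p.2) (0, 0) = 0

theorem pdx_eq_fderiv {g : ℝ → ℝ → ℝ} (hg : Differentiable ℝ (fun p : ℝ × ℝ => g p.1 p.2))
    (x y : ℝ) : pdx g x y = fderiv ℝ (fun p : ℝ × ℝ => g p.1 p.2) (x, y) (1, 0) :=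
  ((hg (x, y)).hasFDerivAt.comp_hasDerivAt (f := fun x' => (x', y)) x
    ((hasDerivAt_id x).prodMk (hasDerivAt_const x y))).deriv

theorem pdy_eq_fderiv {g : ℝ → ℝ → ℝ} (hg : Differentiable ℝ (fun p : ℝ × ℝ => g p.1 p.2))
    (x y : ℝ) : pdy g x y = fderiv ℝ (fun p : ℝ × ℝ => g p.1 p.2) (x, y) (0, 1) :=
  ((hg (x, y)).hasFDerivAt.comp_hasDerivAt (f := fun y' => (x, y')) y
    ((hasDerivAt_const y x).prodMk (hasDerivAt_id y))).deriv

theorem FlatToOrder.differentiable {n : ℕ} {g : ℝ → ℝ → ℝ} (hg : FlatToOrder n g) :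
    Differentiable ℝ (fun p : ℝ × ℝ => g p.1 p.2) :=
  hg.1.differentiable (by simp)

theorem FlatToOrder.continuous {n : ℕ} {g : ℝ → ℝ → ℝ} (hg : FlatToOrder n g) :
    Continuous (fun p : ℝ × ℝ => g p.1 p.2) :=
  hg.1.continuous

theorem FlatToOrder.mono {m n : ℕ} {g : ℝ → ℝ → ℝ} (hg : FlatToOrder n g) (h : m ≤ n) :
    FlatToOrder m g :=
  ⟨hg.1, fun k hk => hg.2 k (hk.trans h)⟩

theorem FlatToOrder.fderiv_apply {n : ℕ} {g h : ℝ → ℝ → ℝ} (hg : FlatToOrder (n + 1) g)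
    (v : ℝ × ℝ) (hh : ∀ x y, h x y = fderiv ℝ (fun p : ℝ × ℝ => g p.1 p.2) (x, y) v) :
    FlatToOrder n h := by
  have hfun : (fun p : ℝ × ℝ => h p.1 p.2)
      = fun p => fderiv ℝ (fun p : ℝ × ℝ => g p.1 p.2) p v := by
    ext p
    exact hh p.1 p.2
  have hsm : ContDiff ℝ (⊤ : ℕ∞) (fderiv ℝ (fun p : ℝ × ℝ => g p.1 p.2)) :=
    hg.1.fderiv_right (by simp)
  refine ⟨hfun ▸ hsm.clm_apply contDiff_const, fun k hk => ?_⟩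
  rw [hfun, ← norm_le_zero_iff]
  refine (norm_iteratedFDeriv_clm_apply_const (n := k) (c := v)
    (hsm.contDiffAt (x := ((0, 0) : ℝ × ℝ))) (by exact_mod_cast le_top)).trans ?_
  rw [norm_iteratedFDeriv_fderiv, hg.2 (k + 1) (by omega)]
  simp

theorem FlatToOrder.pdx {n : ℕ} {g : ℝ → ℝ → ℝ} (hg : FlatToOrder (n + 1) g) :
    FlatToOrder n (pdx g) :=
  hg.fderiv_apply (1, 0) (pdx_eq_fderiv hg.differentiable)

theorem FlatToOrder.pdy {n : ℕ} {g : ℝ → ℝ → ℝ} (hg : FlatToOrder (n + 1) g) :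
    FlatToOrder n (pdy g) :=
  hg.fderiv_apply (0, 1) (pdy_eq_fderiv hg.differentiable)

theorem FlatToOrder.isBigO_norm_sq {g : ℝ → ℝ → ℝ} (hg : FlatToOrder 1 g) :
    (fun p : ℝ × ℝ => g p.1 p.2) =O[𝓝 0] fun p => ‖p‖ ^ 2 := by
  set G : ℝ × ℝ → ℝ := fun p => g p.1 p.2
  have hG0 : G 0 = 0 := by
    have h := hg.2 0 (by norm_num)
    rw [← norm_eq_zero, norm_iteratedFDeriv_zero] at h
    exact norm_eq_zero.1 h
  have hD0 : fderiv ℝ G 0 = 0 := by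
    have h := hg.2 1 le_rfl
    rw [← norm_eq_zero, norm_iteratedFDeriv_one] at h
    exact norm_eq_zero.1 h
  have hsm : ContDiff ℝ (⊤ : ℕ∞) (fderiv ℝ G) := hg.1.fderiv_right (by simp)
  have hO := (hsm.differentiable (by simp) 0).isBigO_sub
  simp only [hD0, sub_zero] at hO
  obtain ⟨C, hC⟩ := hO.bound
  obtain ⟨ε, hε, hball⟩ := Metric.eventually_nhds_iff_ball.1 hC
  refine IsBigO.of_bound |C| ?_
  filter_upwards [Metric.ball_mem_nhds (0 : ℝ × ℝ) hε] with p hp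
  have hC' : ∀ q ∈ Metric.closedBall (0 : ℝ × ℝ) ‖p‖, ‖fderiv ℝ G q‖ ≤ |C| * ‖p‖ := by
    intro q hq
    have hqp : ‖q‖ ≤ ‖p‖ := by simpa using hq
    have hqε : q ∈ Metric.ball (0 : ℝ × ℝ) ε := by
      simp only [mem_ball_zero_iff] at hp ⊢
      exact hqp.trans_lt hp
    calc ‖fderiv ℝ G q‖ ≤ C * ‖q‖ := hball q hqε
      _ ≤ |C| * ‖q‖ := by gcongr; exact le_abs_self C
      _ ≤ |C| * ‖p‖ := by gcongr
  have h := (convex_closedBall (0 : ℝ × ℝ) ‖p‖).norm_image_sub_le_of_norm_fderiv_le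
    (fun q _ => hg.differentiable q) hC' (x := 0) (y := p) (by simp) (by simp)
  change ‖G p - G 0‖ ≤ _ at h
  rw [hG0, sub_zero, sub_zero] at h
  simpa [pow_two, mul_assoc] using h

theorem pdx_add {p p' r : ℝ → ℝ → ℝ} (hp : ∀ x y, DifferentiableAt ℝ (fun x' => p x' y) x)
    (hp' : ∀ x y, deriv (fun x' => p x' y) x = p' x y)
    (hr : Differentiable ℝ (fun q : ℝ × ℝ => r q.1 q.2)) :
    pdx (fun x y => p x y + r x y) = fun x y => p' x y + pdx r x y := by
  ext x y
  have h : DifferentiableAt ℝ (fun x' => r x' y) x :=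
    (hr (x, y)).comp x (f := fun x' => (x', y)) (by fun_prop)
  exact (deriv_fun_add (hp x y) h).trans (congrArg (· + _) (hp' x y))

theorem pdy_add {p p' r : ℝ → ℝ → ℝ} (hp : ∀ x y, DifferentiableAt ℝ (fun y' => p x y') y)
    (hp' : ∀ x y, deriv (fun y' => p x y') y = p' x y)
    (hr : Differentiable ℝ (fun q : ℝ × ℝ => r q.1 q.2)) :
    pdy (fun x y => p x y + r x y) = fun x y => p' x y + pdy r x y := by
  ext x y
  have h : DifferentiableAt ℝ (fun y' => r x y') y :=
    (hr (x, y)).comp y (f := fun y' => (x, y')) (by fun_prop)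
  exact (deriv_fun_add (hp x y) h).trans (congrArg (· + _) (hp' x y))

theorem isBigO_cubic_form_sub {A B C T U W L g : ℝ × ℝ → ℝ}
    (hA : Continuous A) (hB : Continuous B) (hC : Continuous C)
    (hT : Continuous T) (hU : Continuous U) (hW : Continuous W)
    (hAg : (fun p => A p - 1) =O[𝓝 0] g) (hBg : (fun p => B p - 1) =O[𝓝 0] g)
    (hCg : C =O[𝓝 0] g) (hL : (fun p => (1/4) * T p - (3/4) * U p - L p) =O[𝓝 0] g) :
    (fun p => (1/4) * T p * A p * B p - (3/4) * U p * A p ^ 2 + (3/2) * W p * A p * C p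
      - T p * C p ^ 2 - L p) =O[𝓝 0] g := by
  have bdd : ∀ {H K : ℝ × ℝ → ℝ}, H =O[𝓝 0] g → Continuous K →
      (fun p => H p * K p) =O[𝓝 0] g := by
    intro H K hH hK
    simpa using hH.mul ((hK.tendsto 0).isBigO_one ℝ)
  have h1 := bdd hAg (K := fun p => (1/4) * T p * B p - (3/4) * U p * (A p + 1)) (by fun_prop)
  have h2 := bdd hBg (K := fun p => (1/4) * T p) (by fun_prop)
  have h3 := bdd hCg (K := fun p => (3/2) * W p * A p - T p * C p) (by fun_prop)
  refine (((hL.add h1).add h2).add h3).congr_left fun p => ?_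
  ring

theorem isBigO_quadratic_norm_sq {q : ℝ × ℝ → ℝ} (α β γ : ℝ)
    (hq : ∀ p, q p = α * p.1 ^ 2 + β * (p.1 * p.2) + γ * p.2 ^ 2) :
    q =O[𝓝 0] fun p => ‖p‖ ^ 2 := by
  have hx : (fun p : ℝ × ℝ => p.1) =O[𝓝 0] fun p => ‖p‖ :=
    IsBigO.of_bound 1 (.of_forall fun p => by simpa using norm_fst_le p)
  have hy : (fun p : ℝ × ℝ => p.2) =O[𝓝 0] fun p => ‖p‖ :=
    IsBigO.of_bound 1 (.of_forall fun p => by simpa using norm_snd_le p)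
  have hxy := hx.mul hy
  simp only [← pow_two] at hxy
  exact ((((hx.pow 2).const_mul_left α).add (hxy.const_mul_left β)).add
    ((hy.pow 2).const_mul_left γ)).congr_left fun p => (hq p).symm

theorem cubic_form_elliptic_first_order
    (a40 a31 a22 a13 a04 : ℝ) (R f : ℝ → ℝ → ℝ)
    (hR : ContDiff ℝ (⊤ : ℕ∞) (fun p : ℝ × ℝ => R p.1 p.2))
    (hRvan : ∀ k : ℕ, k ≤ 4 → iteratedFDeriv ℝ k (fun p : ℝ × ℝ => R p.1 p.2) (0, 0) = 0)
    (hf : ∀ x y : ℝ, f x y = (1/2)*(x^2 + y^2)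
      + (1/24)*(a40*x^4 + 4*a31*x^3*y + 6*a22*x^2*y^2 + 4*a13*x*y^3 + a04*y^4) + R x y)
    (a b c d : ℝ)
    (ha : a = a40 - 3*a22) (hb : b = a31 - 3*a13)
    (hc : c = a13 - 3*a31) (hd : d = a04 - 3*a22) :
    (fun p : ℝ × ℝ => F111 f p.1 p.2 - (1/4)*(a*p.1 + b*p.2))
        =O[𝓝 (0 : ℝ × ℝ)] (fun p : ℝ × ℝ => ‖p‖^2) ∧
    (fun p : ℝ × ℝ => F222 f p.1 p.2 - (1/4)*(c*p.1 + d*p.2))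
        =O[𝓝 (0 : ℝ × ℝ)] (fun p : ℝ × ℝ => ‖p‖^2) := by
  have hR4 : FlatToOrder 4 R := ⟨hR, hRvan⟩
  have hRx : FlatToOrder 3 (pdx R) := hR4.pdx
  have hRy : FlatToOrder 3 (pdy R) := hR4.pdy
  have hRxx : FlatToOrder 2 (pdx (pdx R)) := hRx.pdx
  have hRyx : FlatToOrder 2 (pdy (pdx R)) := hRx.pdy
  have hRyy : FlatToOrder 2 (pdy (pdy R)) := hRy.pdy
  have hRxxx : FlatToOrder 1 (pdx (pdx (pdx R))) := hRxx.pdx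
  have hRyxx : FlatToOrder 1 (pdy (pdx (pdx R))) := hRxx.pdy
  have hRyyx : FlatToOrder 1 (pdy (pdy (pdx R))) := hRyx.pdy
  have hRyyy : FlatToOrder 1 (pdy (pdy (pdy R))) := hRyy.pdy
  have hf0 : f = fun x y => (1/2)*(x^2 + y^2)
      + (1/24)*(a40*x^4 + 4*a31*x^3*y + 6*a22*x^2*y^2 + 4*a13*x*y^3 + a04*y^4) + R x y := by
    ext x y
    exact hf x y
  have hfx : pdx f = fun x y => x
      + (1/6) * (a40 * x^3 + 3 * a31 * x^2 * y + 3 * a22 * x * y^2 + a13 * y^3)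
      + pdx R x y := by
    rw [hf0]
    exact pdx_add (fun x y => by fun_prop) (fun x y => by
      simp (disch := fun_prop) [deriv_fun_add, deriv_fun_mul, deriv_fun_pow]
      ring) hR4.differentiable
  have hfy : pdy f = fun x y => y
      + (1/6) * (a31 * x^3 + 3 * a22 * x^2 * y + 3 * a13 * x * y^2 + a04 * y^3)
      + pdy R x y := by
    rw [hf0]
    exact pdy_add (fun x y => by fun_prop) (fun x y => by
      simp (disch := fun_prop) [deriv_fun_add, deriv_fun_mul, deriv_fun_pow]
      ring) hR4.differentiable
  have hfxx : pdx (pdx f) = fun x y => 1 + (1/2) * (a40 * x^2 + 2 * a31 * (x * y) + a22 * y^2)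
      + pdx (pdx R) x y := by
    rw [hfx]
    exact pdx_add (fun x y => by fun_prop) (fun x y => by
      simp (disch := fun_prop) [deriv_fun_add, deriv_fun_mul, deriv_fun_pow]
      ring) hRx.differentiable
  have hfyx : pdy (pdx f) = fun x y => (1/2) * (a31 * x^2 + 2 * a22 * (x * y) + a13 * y^2)
      + pdy (pdx R) x y := by
    rw [hfx]
    exact pdy_add (fun x y => by fun_prop) (fun x y => by
      simp (disch := fun_prop) [deriv_fun_add, deriv_fun_mul, deriv_fun_pow]
      ring) hRx.differentiable
  have hfyy : pdy (pdy f) = fun x y => 1 + (1/2) * (a22 * x^2 + 2 * a13 * (x * y) + a04 * y^2)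
      + pdy (pdy R) x y := by
    rw [hfy]
    exact pdy_add (fun x y => by fun_prop) (fun x y => by
      simp (disch := fun_prop) [deriv_fun_add, deriv_fun_mul, deriv_fun_pow]
      ring) hRy.differentiable
  have hfxxx : pdx (pdx (pdx f)) = fun x y => a40 * x + a31 * y + pdx (pdx (pdx R)) x y := by
    rw [hfxx]
    exact pdx_add (fun x y => by fun_prop) (fun x y => by
      simp (disch := fun_prop) [deriv_fun_add, deriv_fun_mul, deriv_fun_pow]
      ring) hRxx.differentiable
  have hfyxx : pdy (pdx (pdx f)) = fun x y => a31 * x + a22 * y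
      + pdy (pdx (pdx R)) x y := by
    rw [hfxx]
    exact pdy_add (fun x y => by fun_prop) (fun x y => by
      simp (disch := fun_prop) [deriv_fun_add, deriv_fun_mul, deriv_fun_pow]
      ring) hRxx.differentiable
  have hfyyx : pdy (pdy (pdx f)) = fun x y => a22 * x + a13 * y
      + pdy (pdy (pdx R)) x y := by
    rw [hfyx]
    exact pdy_add (fun x y => by fun_prop) (fun x y => by
      simp (disch := fun_prop) [deriv_fun_add, deriv_fun_mul, deriv_fun_pow]
      ring) hRyx.differentiable
  have hfyyy : pdy (pdy (pdy f)) = fun x y => a13 * x + a04 * y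
      + pdy (pdy (pdy R)) x y := by
    rw [hfyy]
    exact pdy_add (fun x y => by fun_prop) (fun x y => by
      simp (disch := fun_prop) [deriv_fun_add, deriv_fun_mul, deriv_fun_pow]
      ring) hRyy.differentiable
  have hoxx : (fun p : ℝ × ℝ => pdx (pdx f) p.1 p.2 - 1) =O[𝓝 0] fun p => ‖p‖ ^ 2 := by
    refine ((isBigO_quadratic_norm_sq (a40/2) a31 (a22/2) fun _ => rfl).add
      (hRxx.mono one_le_two).isBigO_norm_sq).congr_left fun p => ?_
    rw [hfxx]
    ring
  have hoyx : (fun p : ℝ × ℝ => pdy (pdx f) p.1 p.2) =O[𝓝 0] fun p => ‖p‖ ^ 2 := by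
    refine ((isBigO_quadratic_norm_sq (a31/2) a22 (a13/2) fun _ => rfl).add
      (hRyx.mono one_le_two).isBigO_norm_sq).congr_left fun p => ?_
    rw [hfyx]
    ring
  have hoyy : (fun p : ℝ × ℝ => pdy (pdy f) p.1 p.2 - 1) =O[𝓝 0] fun p => ‖p‖ ^ 2 := by
    refine ((isBigO_quadratic_norm_sq (a22/2) a13 (a04/2) fun _ => rfl).add
      (hRyy.mono one_le_two).isBigO_norm_sq).congr_left fun p => ?_
    rw [hfyy]
    ring
  have hcxx : Continuous fun p : ℝ × ℝ => pdx (pdx f) p.1 p.2 := by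
    have := hRxx.continuous
    rw [hfxx]
    fun_prop
  have hcyx : Continuous fun p : ℝ × ℝ => pdy (pdx f) p.1 p.2 := by
    have := hRyx.continuous
    rw [hfyx]
    fun_prop
  have hcyy : Continuous fun p : ℝ × ℝ => pdy (pdy f) p.1 p.2 := by
    have := hRyy.continuous
    rw [hfyy]
    fun_prop
  have hcxxx : Continuous fun p : ℝ × ℝ => pdx (pdx (pdx f)) p.1 p.2 := by
    have := hRxxx.continuous
    rw [hfxxx]
    fun_prop
  have hcyxx : Continuous fun p : ℝ × ℝ => pdy (pdx (pdx f)) p.1 p.2 := by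
    have := hRyxx.continuous
    rw [hfyxx]
    fun_prop
  have hcyyx : Continuous fun p : ℝ × ℝ => pdy (pdy (pdx f)) p.1 p.2 := by
    have := hRyyx.continuous
    rw [hfyyx]
    fun_prop
  have hcyyy : Continuous fun p : ℝ × ℝ => pdy (pdy (pdy f)) p.1 p.2 := by
    have := hRyyy.continuous
    rw [hfyyy]
    fun_prop
  constructor
  · refine (isBigO_cubic_form_sub hcxx hcyy hcyx hcxxx hcyyx hcyxx hoxx hoyy hoyx
      (L := fun p => (1/4) * (a * p.1 + b * p.2)) ?_).congr_left fun p => ?_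
    · refine ((hRxxx.isBigO_norm_sq.const_mul_left (1/4)).sub
        (hRyyx.isBigO_norm_sq.const_mul_left (3/4))).congr_left fun p => ?_
      rw [hfxxx, hfyyx, ha, hb]
      ring
    · rw [F111]
  · refine (isBigO_cubic_form_sub hcyy hcxx hcyx hcyyy hcyxx hcyyx hoyy hoxx hoyx
      (L := fun p => (1/4) * (c * p.1 + d * p.2)) ?_).congr_left fun p => ?_
    · refine ((hRyyy.isBigO_norm_sq.const_mul_left (1/4)).sub
        (hRyxx.isBigO_norm_sq.const_mul_left (3/4))).congr_left fun p => ?_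
      rw [hfyyy, hfyxx, hc, hd]
      ring
    · rw [F222]
      ring
end

section
/- Let n ≥ 1 be a natural number, let h : ℝ² → ℝ be a homogeneous polynomial of degree n + 3, and let f : ℝ² → ℝ be given by f(x,y) = (1/2)(x²+y²) + h(x,y) + R(x,y), where R is smooth with all partial derivatives of order ≤ n + 3 vanishing at the origin. Then, as (x,y) → (0,0), F₁₁₁(f)(x,y) − (1/4)(h_xxx − 3h_xyy)(x,y) = O(‖(x,y)‖^{n+1}) and F₂₂₂(f)(x,y) − (1/4)(h_yyy − 3h_xxy)(x,y) = O(‖(x,y)‖^{n+1}). -/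
open Topology Asymptotics

universe u

/-- A smooth map whose derivatives of order `< m` vanish at the origin is `O(‖x‖ ^ m)` there. -/
theorem isBigO_norm_pow_of_iteratedFDeriv_eq_zero {E : Type u} [NormedAddCommGroup E]
    [NormedSpace ℝ E] (m : ℕ) :
    ∀ {F : Type u} [NormedAddCommGroup F] [NormedSpace ℝ F] {g : E → F},
      ContDiff ℝ (⊤ : ℕ∞) g → (∀ k < m, iteratedFDeriv ℝ k g 0 = 0) →
      g =O[𝓝 0] fun x => ‖x‖ ^ m := by
  induction m with
  | zero =>
    intro F _ _ g hg _
    simpa using hg.continuous.continuousAt.isBigO_one ℝ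
  | succ m ih =>
    intro F _ _ g hg hv
    have hd : ContDiff ℝ (⊤ : ℕ∞) (fderiv ℝ g) := hg.fderiv_right (by simp)
    have hv' : ∀ k < m, iteratedFDeriv ℝ k (fderiv ℝ g) 0 = 0 := fun k hk => by
      rw [← norm_eq_zero, norm_iteratedFDeriv_fderiv, hv (k + 1) (by omega), norm_zero]
    have hg0 : g 0 = 0 := by
      rw [← norm_eq_zero, ← norm_iteratedFDeriv_zero (𝕜 := ℝ), hv 0 (by omega), norm_zero]
    obtain ⟨C, hC0, hC⟩ := (ih hd hv').exists_nonneg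
    obtain ⟨ε, hε, hball⟩ := Metric.eventually_nhds_iff_ball.1 hC.bound
    refine IsBigO.of_bound C ?_
    filter_upwards [Metric.ball_mem_nhds (0 : E) hε] with x hx
    have hx' : ‖x‖ < ε := by simpa using hx
    have key := (convex_closedBall (0 : E) ‖x‖).norm_image_sub_le_of_norm_fderiv_le
      (f := g) (C := C * ‖x‖ ^ m) (x := 0) (y := x) (𝕜 := ℝ)
      (fun z _ => (hg.differentiable (by simp)).differentiableAt)
      (fun z hz => by
        have hz' : ‖z‖ ≤ ‖x‖ := by simpa using hz
        refine (hball z (by simpa using hz'.trans_lt hx')).trans ?_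
        rw [norm_pow, norm_norm]
        gcongr)
      (by simp) (by simp)
    rw [hg0, sub_zero, sub_zero] at key
    rw [norm_pow, norm_norm, pow_succ, ← mul_assoc]
    exact key

/-- `r` is smooth and its derivatives of order `< m` vanish at the origin. -/
structure IsFlatToOrder (m : ℕ) (r : ℝ → ℝ → ℝ) : Prop where
  contDiff : ContDiff ℝ (⊤ : ℕ∞) (fun p : ℝ × ℝ => r p.1 p.2)
  iteratedFDeriv_eq_zero : ∀ k < m, iteratedFDeriv ℝ k (fun p : ℝ × ℝ => r p.1 p.2) 0 = 0

namespace IsFlatToOrder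

variable {m : ℕ} {r : ℝ → ℝ → ℝ}

theorem isBigO (hr : IsFlatToOrder m r) :
    (fun p : ℝ × ℝ => r p.1 p.2) =O[𝓝 0] fun p => ‖p‖ ^ m :=
  isBigO_norm_pow_of_iteratedFDeriv_eq_zero m hr.contDiff hr.iteratedFDeriv_eq_zero

theorem continuous (hr : IsFlatToOrder m r) : Continuous fun p : ℝ × ℝ => r p.1 p.2 :=
  hr.contDiff.continuous

theorem hasFDerivAt (hr : IsFlatToOrder m r) (p : ℝ × ℝ) :
    HasFDerivAt (fun p : ℝ × ℝ => r p.1 p.2) (fderiv ℝ (fun p : ℝ × ℝ => r p.1 p.2) p) p :=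
  (hr.contDiff.differentiable (by simp) p).hasFDerivAt

theorem hasDerivAt_fst (hr : IsFlatToOrder m r) (x y : ℝ) :
    HasDerivAt (fun x' => r x' y) (fderiv ℝ (fun p : ℝ × ℝ => r p.1 p.2) (x, y) (1, 0)) x :=
  (hr.hasFDerivAt (x, y)).comp_hasDerivAt (f := fun x' => (x', y)) x
    ((hasDerivAt_id x).prodMk (hasDerivAt_const x y))

theorem hasDerivAt_snd (hr : IsFlatToOrder m r) (x y : ℝ) :
    HasDerivAt (fun y' => r x y') (fderiv ℝ (fun p : ℝ × ℝ => r p.1 p.2) (x, y) (0, 1)) y :=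
  (hr.hasFDerivAt (x, y)).comp_hasDerivAt (f := fun y' => (x, y')) y
    ((hasDerivAt_const y x).prodMk (hasDerivAt_id y))

theorem fderiv_apply (hr : IsFlatToOrder (m + 1) r) (v : ℝ × ℝ) :
    IsFlatToOrder m fun x y => fderiv ℝ (fun p : ℝ × ℝ => r p.1 p.2) (x, y) v := by
  have hd : ContDiff ℝ (⊤ : ℕ∞) (fderiv ℝ fun p : ℝ × ℝ => r p.1 p.2) :=
    hr.contDiff.fderiv_right (by simp)
  refine ⟨hd.clm_apply contDiff_const, fun k hk => ?_⟩
  have h0 : iteratedFDeriv ℝ k (fderiv ℝ fun p : ℝ × ℝ => r p.1 p.2) 0 = 0 := by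
    rw [← norm_eq_zero, norm_iteratedFDeriv_fderiv, hr.iteratedFDeriv_eq_zero _ (by omega),
      norm_zero]
  have := (ContinuousLinearMap.apply ℝ ℝ v).iteratedFDeriv_comp_left
    (hd.contDiffAt (x := (0 : ℝ × ℝ))) (i := k) (by exact_mod_cast le_top)
  rw [h0] at this
  refine Eq.trans this ?_
  ext
  simp

theorem pdx (hr : IsFlatToOrder (m + 1) r) : IsFlatToOrder m (pdx r) := by
  convert hr.fderiv_apply (1, 0) using 3
  exact (hr.hasDerivAt_fst _ _).deriv

theorem pdy (hr : IsFlatToOrder (m + 1) r) : IsFlatToOrder m (pdy r) := by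
  convert hr.fderiv_apply (0, 1) using 3
  exact (hr.hasDerivAt_snd _ _).deriv

end IsFlatToOrder

namespace MvPolynomial

theorem hasDerivAt_eval_fst (Q : MvPolynomial (Fin 2) ℝ) (x y : ℝ) :
    HasDerivAt (fun x' => eval ![x', y] Q) (eval ![x, y] (pderiv 0 Q)) x := by
  induction Q using MvPolynomial.induction_on with
  | C a => simpa using hasDerivAt_const x a
  | add p q hp hq => simpa using hp.fun_add hq
  | mul_X p i hp =>
    fin_cases i
    · simpa [add_comm, mul_comm] using hp.fun_mul (hasDerivAt_id x)
    · simpa [add_comm, mul_comm] using hp.fun_mul (hasDerivAt_const x y)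

theorem hasDerivAt_eval_snd (Q : MvPolynomial (Fin 2) ℝ) (x y : ℝ) :
    HasDerivAt (fun y' => eval ![x, y'] Q) (eval ![x, y] (pderiv 1 Q)) y := by
  induction Q using MvPolynomial.induction_on with
  | C a => simpa using hasDerivAt_const y a
  | add p q hp hq => simpa using hp.fun_add hq
  | mul_X p i hp =>
    fin_cases i
    · simpa [add_comm, mul_comm] using hp.fun_mul (hasDerivAt_const y x)
    · simpa [add_comm, mul_comm] using hp.fun_mul (hasDerivAt_id y)

theorem continuous_eval_pair (Q : MvPolynomial (Fin 2) ℝ) :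
    Continuous fun p : ℝ × ℝ => eval ![p.1, p.2] Q :=
  (continuous_eval Q).comp (by fun_prop)

/-- A homogeneous polynomial of degree `d` is `O(‖p‖ ^ d)` at the origin. -/
theorem IsHomogeneous.isBigO_eval_pair {Q : MvPolynomial (Fin 2) ℝ} {d : ℕ}
    (hQ : Q.IsHomogeneous d) :
    (fun p : ℝ × ℝ => eval ![p.1, p.2] Q) =O[𝓝 0] fun p => ‖p‖ ^ d := by
  simp only [eval_eq']
  refine IsBigO.fun_sum fun s hs => (IsBigO.of_bound 1 (.of_forall fun p => ?_)).const_mul_left _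
  have hd : s 0 + s 1 = d := by
    have := hQ (mem_support_iff.1 hs)
    simpa [Finsupp.weight_apply, Finsupp.sum_fintype, Fin.sum_univ_two] using this
  simp only [Fin.prod_univ_two, Matrix.cons_val_zero, Matrix.cons_val_one, norm_mul, norm_pow,
    norm_norm, one_mul, ← hd, pow_add]
  gcongr
  · exact norm_fst_le p
  · exact norm_snd_le p

end MvPolynomial

open MvPolynomial in
theorem pdx_eval_add {m : ℕ} {r : ℝ → ℝ → ℝ} (hr : IsFlatToOrder m r)
    (Q : MvPolynomial (Fin 2) ℝ) :
    pdx (fun x y => eval ![x, y] Q + r x y) = fun x y => eval ![x, y] (pderiv 0 Q) + pdx r x y := by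
  funext x y
  exact ((hasDerivAt_eval_fst Q x y).add (hr.hasDerivAt_fst x y).differentiableAt.hasDerivAt).deriv

open MvPolynomial in
theorem pdy_eval_add {m : ℕ} {r : ℝ → ℝ → ℝ} (hr : IsFlatToOrder m r)
    (Q : MvPolynomial (Fin 2) ℝ) :
    pdy (fun x y => eval ![x, y] Q + r x y) = fun x y => eval ![x, y] (pderiv 1 Q) + pdy r x y := by
  funext x y
  exact ((hasDerivAt_eval_snd Q x y).add (hr.hasDerivAt_snd x y).differentiableAt.hasDerivAt).deriv

open MvPolynomial in
theorem pdx_eval (Q : MvPolynomial (Fin 2) ℝ) :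
    pdx (fun x y => eval ![x, y] Q) = fun x y => eval ![x, y] (pderiv 0 Q) := by
  funext x y
  exact (hasDerivAt_eval_fst Q x y).deriv

open MvPolynomial in
theorem pdy_eval (Q : MvPolynomial (Fin 2) ℝ) :
    pdy (fun x y => eval ![x, y] Q) = fun x y => eval ![x, y] (pderiv 1 Q) := by
  funext x y
  exact (hasDerivAt_eval_snd Q x y).deriv

theorem Asymptotics.IsBigO.mul_continuous {X : Type*} [TopologicalSpace X] {x₀ : X}
    {u v g : X → ℝ} (hu : u =O[𝓝 x₀] g) (hv : Continuous v) :
    (fun x => u x * v x) =O[𝓝 x₀] g := by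
  simpa using hu.mul (hv.continuousAt.isBigO_one ℝ)

/-- The polynomial expression common to the extreme components of the cubic form, when the Hessian
is `O(g)`-close to the identity and the pure third derivatives are `O(g)`-close to `h₁`, `h₂`. -/
theorem Asymptotics.IsBigO.cubic_form_component {X : Type*} [TopologicalSpace X] {x₀ : X}
    {a b c r₁ r₂ h₁ h₂ w g : X → ℝ} (ha : a =O[𝓝 x₀] g) (hb : b =O[𝓝 x₀] g) (hc : c =O[𝓝 x₀] g)
    (hr₁ : r₁ =O[𝓝 x₀] g) (hr₂ : r₂ =O[𝓝 x₀] g) (ca : Continuous a) (cb : Continuous b)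
    (cc : Continuous c) (cr₁ : Continuous r₁) (cr₂ : Continuous r₂) (ch₁ : Continuous h₁)
    (ch₂ : Continuous h₂) (cw : Continuous w) :
    (fun x => (1 / 4) * (h₁ x + r₁ x) * (1 + a x) * (1 + c x)
      - (3 / 4) * (h₂ x + r₂ x) * (1 + a x) ^ 2 + (3 / 2) * w x * (1 + a x) * b x
      - (h₁ x + r₁ x) * b x ^ 2 - (1 / 4) * (h₁ x - 3 * h₂ x)) =O[𝓝 x₀] g := by
  have key := ((((hr₁.const_mul_left (1 / 4)).sub (hr₂.const_mul_left (3 / 4))).add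
    (ha.mul_continuous (v := fun x => (1 / 4) * (h₁ x + r₁ x) * (1 + c x)
      - (3 / 4) * (h₂ x + r₂ x) * (2 + a x)) (by fun_prop))).add
    (hb.mul_continuous (v := fun x => (3 / 2) * w x * (1 + a x) - (h₁ x + r₁ x) * b x)
      (by fun_prop))).add
    (hc.mul_continuous (v := fun x => (1 / 4) * (h₁ x + r₁ x)) (by fun_prop))
  exact key.congr_left fun x => by ring

theorem cubic_form_semihomogeneous_jet
    (n : ℕ) (hn : 1 ≤ n)
    (P : MvPolynomial (Fin 2) ℝ) (hP : P.IsHomogeneous (n + 3))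
    (h : ℝ → ℝ → ℝ) (hh : ∀ x y : ℝ, h x y = MvPolynomial.eval ![x, y] P)
    (R f : ℝ → ℝ → ℝ)
    (hR : ContDiff ℝ (⊤ : ℕ∞) (fun p : ℝ × ℝ => R p.1 p.2))
    (hRvan : ∀ k : ℕ, k ≤ n + 3 → iteratedFDeriv ℝ k (fun p : ℝ × ℝ => R p.1 p.2) (0, 0) = 0)
    (hf : ∀ x y : ℝ, f x y = (1/2)*(x^2 + y^2) + h x y + R x y) :
    (fun p : ℝ × ℝ =>
        F111 f p.1 p.2 - (1/4)*(pdx (pdx (pdx h)) p.1 p.2 - 3 * pdy (pdy (pdx h)) p.1 p.2))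
      =O[𝓝 (0 : ℝ × ℝ)] (fun p : ℝ × ℝ => ‖p‖^(n+1)) ∧
    (fun p : ℝ × ℝ =>
        F222 f p.1 p.2 - (1/4)*(pdy (pdy (pdy h)) p.1 p.2 - 3 * pdy (pdx (pdx h)) p.1 p.2))
      =O[𝓝 (0 : ℝ × ℝ)] (fun p : ℝ × ℝ => ‖p‖^(n+1)) := by
  obtain rfl : h = fun x y => MvPolynomial.eval ![x, y] P := by funext x y; exact hh x y
  have hR0 : IsFlatToOrder (n + 4) R := ⟨hR, fun k hk => hRvan k (by omega)⟩
  have hR0xx := hR0.pdx.pdx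
  have hR0xy := hR0.pdx.pdy
  have hR0yy := hR0.pdy.pdy
  set Q : MvPolynomial (Fin 2) ℝ :=
    MvPolynomial.C (1 / 2) * (MvPolynomial.X 0 ^ 2 + MvPolynomial.X 1 ^ 2) + P with hQ
  obtain rfl : f = fun x y => MvPolynomial.eval ![x, y] Q + R x y := by
    funext x y
    simp [hf, hQ]
  have hC : MvPolynomial.C 2⁻¹ * 2 = (1 : MvPolynomial (Fin 2) ℝ) := by
    rw [← map_ofNat MvPolynomial.C 2, ← map_mul]
    norm_num
  have hQ0 : MvPolynomial.pderiv 0 Q = MvPolynomial.X 0 + MvPolynomial.pderiv 0 P := by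
    simp [hQ, ← mul_assoc, hC]
  have hQ1 : MvPolynomial.pderiv 1 Q = MvPolynomial.X 1 + MvPolynomial.pderiv 1 P := by
    simp [hQ, ← mul_assoc, hC]
  have second (i j : Fin 2) {r : ℝ → ℝ → ℝ} (hr : IsFlatToOrder (n + 2) r) :
      (fun p : ℝ × ℝ => MvPolynomial.eval ![p.1, p.2] (MvPolynomial.pderiv j
        (MvPolynomial.pderiv i P)) + r p.1 p.2) =O[𝓝 0] fun p => ‖p‖ ^ (n + 1) :=
    hP.pderiv.pderiv.isBigO_eval_pair.add
      (hr.isBigO.trans (isLittleO_norm_pow_norm_pow (by omega)).isBigO)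
  have hxx := second 0 0 hR0xx
  have hxy := second 0 1 hR0xy
  have hyy := second 1 1 hR0yy
  have cP := MvPolynomial.continuous_eval_pair
  simp only [F111, F222, pdx_eval_add hR0, pdx_eval_add hR0.pdx, pdx_eval_add hR0xx,
    pdy_eval_add hR0, pdy_eval_add hR0.pdx, pdy_eval_add hR0.pdy, pdy_eval_add hR0xx,
    pdy_eval_add hR0xy, pdy_eval_add hR0yy, pdx_eval, pdy_eval]
  simp only [hQ0, hQ1, map_add, MvPolynomial.pderiv_X_self,
    MvPolynomial.pderiv_X_of_ne zero_ne_one, map_one, zero_add,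
    Derivation.map_one_eq_zero, add_assoc (1 : ℝ)]
  exact ⟨hxx.cubic_form_component hxy hyy hR0xx.pdx.isBigO hR0xy.pdy.isBigO
      ((cP _).add hR0xx.continuous) ((cP _).add hR0xy.continuous) ((cP _).add hR0yy.continuous)
      hR0xx.pdx.continuous hR0xy.pdy.continuous (cP _) (cP _) ((cP _).add hR0xx.pdy.continuous),
    (hyy.cubic_form_component hxy hxx hR0yy.pdy.isBigO hR0xx.pdy.isBigO
      ((cP _).add hR0yy.continuous) ((cP _).add hR0xy.continuous) ((cP _).add hR0xx.continuous)
      hR0yy.pdy.continuous hR0xx.pdy.continuous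
      (cP (MvPolynomial.pderiv 1 (MvPolynomial.pderiv 1 (MvPolynomial.pderiv 1 P))))
      (cP (MvPolynomial.pderiv 1 (MvPolynomial.pderiv 0 (MvPolynomial.pderiv 0 P))))
      ((cP (MvPolynomial.pderiv 1 (MvPolynomial.pderiv 1 (MvPolynomial.pderiv 0 P)))).fun_add
        hR0xy.pdy.continuous)).congr_left fun p => by ring⟩
end

section
/- Let n ≥ 1 be a natural number and let G : ℝ² → ℂ be a continuous map that is positively homogeneous of degree n (G(r·v) = rⁿ·G(v) for all r > 0 and v ∈ ℝ²) and satisfies G(v) ≠ 0 for all v ≠ (0,0). Let F : ℝ² → ℂ be continuous with F(v) − G(v) = O(‖v‖^{n+1}) as v → (0,0). Then there exists r₀ > 0 such that for every r with 0 < r ≤ r₀: (i) F(v) ≠ 0 for all v with 0 < ‖v‖ ≤ r; and (ii) the loops γ_F, γ_G : [0, 2π] → ℂ \ {0} given by γ_F(t) = F(r cos t, r sin t) and γ_G(t) = G(r cos t, r sin t) are homotopic as loops in ℂ \ {0} (freely homotopic through loops taking values in ℂ \ {0}). -/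
open Topology Asymptotics Real

/-- A continuous positively homogeneous map of degree `n` that vanishes at most at the origin is
bounded below by a positive multiple of `‖v‖ ^ n` away from the origin. -/
theorem exists_pos_mul_norm_pow_le_of_homogeneous {E : Type*} [NormedAddCommGroup E]
    [NormedSpace ℝ E] [ProperSpace E] {n : ℕ} {G : E → ℂ} (hGcont : Continuous G)
    (hGhom : ∀ r : ℝ, 0 < r → ∀ v : E, G (r • v) = (r : ℂ) ^ n * G v)
    (hGne : ∀ v : E, v ≠ 0 → G v ≠ 0) :
    ∃ m : ℝ, 0 < m ∧ ∀ v : E, v ≠ 0 → m * ‖v‖ ^ n ≤ ‖G v‖ := by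
  obtain ⟨m, hm, hle⟩ := (isCompact_sphere (0 : E) 1).exists_forall_le' (a := 0)
    hGcont.norm.continuousOn fun v hv ↦
      norm_pos_iff.2 (hGne v (ne_zero_of_mem_unit_sphere ⟨v, hv⟩))
  refine ⟨m, hm, fun v hv ↦ ?_⟩
  have hpos : 0 < ‖v‖ := norm_pos_iff.2 hv
  have hmem : ‖v‖⁻¹ • v ∈ Metric.sphere (0 : E) 1 := by
    simp [norm_smul, hpos.ne']
  have hG : G v = (‖v‖ : ℂ) ^ n * G (‖v‖⁻¹ • v) := by
    rw [← hGhom _ hpos, smul_inv_smul₀ hpos.ne']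
  rw [hG, norm_mul, norm_pow, Complex.norm_real, norm_norm, mul_comm]
  gcongr
  exact hle _ hmem

/-- A perturbation of order `‖v‖ ^ (n + 1)` of a map bounded below by a multiple of `‖v‖ ^ n` is
strictly dominated by that map near the origin. -/
theorem exists_pos_forall_norm_sub_lt {E : Type*} [NormedAddCommGroup E] {n : ℕ} {F G : E → ℂ}
    {m : ℝ} (hm : 0 < m) (hG : ∀ v : E, v ≠ 0 → m * ‖v‖ ^ n ≤ ‖G v‖)
    (hFG : (fun v : E ↦ F v - G v) =O[𝓝 (0 : E)] fun v : E ↦ ‖v‖ ^ (n + 1)) :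
    ∃ r₀ : ℝ, 0 < r₀ ∧ ∀ v : E, v ≠ 0 → ‖v‖ ≤ r₀ → ‖F v - G v‖ < ‖G v‖ := by
  obtain ⟨C, hC, hbound⟩ := hFG.exists_pos
  obtain ⟨δ, hδ, hball⟩ := Metric.eventually_nhds_iff.1 hbound.bound
  refine ⟨min (δ / 2) (m / (2 * C)), by positivity, fun v hv hle ↦ ?_⟩
  have hpos : 0 < ‖v‖ := norm_pos_iff.2 hv
  have hlt : C * ‖v‖ < m := by
    have := (le_div_iff₀ (by positivity)).1 (hle.trans (min_le_right _ _))
    nlinarith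
  calc ‖F v - G v‖ ≤ C * ‖‖v‖ ^ (n + 1)‖ := hball (by
        rw [dist_zero_right]
        linarith [hle.trans (min_le_left _ _)])
    _ = C * ‖v‖ * ‖v‖ ^ n := by rw [norm_pow, norm_norm]; ring
    _ < m * ‖v‖ ^ n := by gcongr
    _ ≤ ‖G v‖ := hG v hv

/-- If `‖a - b‖ < ‖b‖`, then the segment from `a` to `b` avoids the origin. -/
theorem add_mul_sub_ne_zero_of_norm_sub_lt {a b : ℂ} (h : ‖a - b‖ < ‖b‖) {s : ℝ}
    (hs : s ∈ Set.Icc (0 : ℝ) 1) : a + (s : ℂ) * (b - a) ≠ 0 := by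
  intro h0
  have hb : b = -((1 - s : ℝ) : ℂ) * (a - b) := by
    push_cast
    linear_combination h0
  have hnorm : ‖b‖ = (1 - s) * ‖a - b‖ := by
    conv_lhs => rw [hb]
    rw [norm_mul, norm_neg, Complex.norm_real, Real.norm_of_nonneg (sub_nonneg.2 hs.2)]
  nlinarith [hs.1, norm_nonneg (a - b)]

theorem winding_determined_by_homogeneous_part
    (n : ℕ) (hn : 1 ≤ n)
    (G : ℝ × ℝ → ℂ) (hGcont : Continuous G)
    (hGhom : ∀ r : ℝ, 0 < r → ∀ v : ℝ × ℝ, G (r • v) = (r : ℂ)^n * G v)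
    (hGne : ∀ v : ℝ × ℝ, v ≠ 0 → G v ≠ 0)
    (F : ℝ × ℝ → ℂ) (hFcont : Continuous F)
    (hFG : (fun v : ℝ × ℝ => F v - G v) =O[𝓝 (0 : ℝ × ℝ)] (fun v : ℝ × ℝ => ‖v‖^(n+1))) :
    ∃ r₀ : ℝ, 0 < r₀ ∧ ∀ r : ℝ, 0 < r → r ≤ r₀ →
      (∀ v : ℝ × ℝ, 0 < ‖v‖ → ‖v‖ ≤ r → F v ≠ 0) ∧
      ∃ H : ℝ × ℝ → ℂ,
        ContinuousOn H (Set.Icc (0:ℝ) 1 ×ˢ Set.Icc (0:ℝ) (2*π)) ∧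
        (∀ t ∈ Set.Icc (0:ℝ) (2*π), H (0, t) = F (r * Real.cos t, r * Real.sin t)) ∧
        (∀ t ∈ Set.Icc (0:ℝ) (2*π), H (1, t) = G (r * Real.cos t, r * Real.sin t)) ∧
        (∀ s ∈ Set.Icc (0:ℝ) 1, H (s, 0) = H (s, 2*π)) ∧
        (∀ s ∈ Set.Icc (0:ℝ) 1, ∀ t ∈ Set.Icc (0:ℝ) (2*π), H (s, t) ≠ 0) := by
  obtain ⟨m, hm, hlower⟩ := exists_pos_mul_norm_pow_le_of_homogeneous hGcont hGhom hGne
  obtain ⟨r₀, hr₀, hlt⟩ := exists_pos_forall_norm_sub_lt hm hlower hFG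
  refine ⟨r₀, hr₀, fun r hr hrr₀ ↦ ⟨fun v hv hvr ↦ ?_, ?_⟩⟩
  · simpa using add_mul_sub_ne_zero_of_norm_sub_lt
      (hlt v (norm_pos_iff.1 hv) (hvr.trans hrr₀)) (s := 0) (by simp)
  · refine ⟨fun p ↦ F (r * Real.cos p.2, r * Real.sin p.2) + (p.1 : ℂ) *
      (G (r * Real.cos p.2, r * Real.sin p.2) - F (r * Real.cos p.2, r * Real.sin p.2)),
      by fun_prop, by simp, by simp, by simp, fun s hs t _ ↦
        add_mul_sub_ne_zero_of_norm_sub_lt (hlt _ ?_ ?_) hs⟩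
    · intro h0
      obtain ⟨hcos, hsin⟩ := Prod.mk_eq_zero.1 h0
      have := Real.sin_sq_add_cos_sq t
      simp_all [hr.ne']
    · refine le_trans ?_ hrr₀
      rw [Prod.norm_mk, max_le_iff]
      simp only [norm_mul, Real.norm_eq_abs, abs_of_pos hr]
      exact ⟨mul_le_of_le_one_right hr.le (Real.abs_cos_le_one t),
        mul_le_of_le_one_right hr.le (Real.abs_sin_le_one t)⟩
end

section
/- Let a, b, c, d be real numbers, let I ⊆ ℝ be an open interval, and let θ : I → ℝ be a differentiable function such that for every t ∈ I one has a cos t + b sin t ≠ 0 and sin(3θ(t))·(a cos t + b sin t) = cos(3θ(t))·(c cos t + d sin t). Then for every t ∈ I, θ'(t) = (ad − bc) / (3·((a cos t + b sin t)² + (c cos t + d sin t)²)). -/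
theorem web_angle_derivative
    (a b c d : ℝ) (l u : ℝ) (θ : ℝ → ℝ)
    (hθ : ∀ t ∈ Set.Ioo l u, DifferentiableAt ℝ θ t)
    (hne : ∀ t ∈ Set.Ioo l u, a * Real.cos t + b * Real.sin t ≠ 0)
    (hrel : ∀ t ∈ Set.Ioo l u,
      Real.sin (3 * θ t) * (a * Real.cos t + b * Real.sin t)
        = Real.cos (3 * θ t) * (c * Real.cos t + d * Real.sin t)) :
    ∀ t ∈ Set.Ioo l u,
      deriv θ t = (a*d - b*c) /
        (3 * ((a * Real.cos t + b * Real.sin t)^2 + (c * Real.cos t + d * Real.sin t)^2)) := by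
  intro t ht
  have hlin : ∀ p q : ℝ, HasDerivAt (fun x => p * Real.cos x + q * Real.sin x)
      (p * -Real.sin t + q * Real.cos t) t := fun p q =>
    ((Real.hasDerivAt_cos t).const_mul p).add ((Real.hasDerivAt_sin t).const_mul q)
  have h3θ : HasDerivAt (fun x => 3 * θ x) (3 * deriv θ t) t :=
    (hθ t ht).hasDerivAt.const_mul 3
  have hl := h3θ.sin.mul (hlin a b)
  have hr := h3θ.cos.mul (hlin c d)
  have hderiv := (hl.congr_of_eventuallyEq
    (Filter.eventually_of_mem (isOpen_Ioo.mem_nhds ht) fun x hx => (hrel x hx).symm)).unique hr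
  have hX := hne t ht
  have hXY := hrel t ht
  have hcos : Real.cos (3 * θ t) ≠ 0 := by
    intro h0
    have hsin : Real.sin (3 * θ t) = 0 := by simpa [h0, hX] using hXY
    simpa [h0, hsin] using Real.sin_sq_add_cos_sq (3 * θ t)
  have hpos : 0 < 3 * ((a * Real.cos t + b * Real.sin t) ^ 2
      + (c * Real.cos t + d * Real.sin t) ^ 2) := by positivity
  rw [eq_div_iff hpos.ne']
  apply mul_left_cancel₀ hcos
  linear_combination (a * Real.cos t + b * Real.sin t) * hderiv
    - (3 * deriv θ t * (c * Real.cos t + d * Real.sin t)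
      + (a * -Real.sin t + b * Real.cos t)) * hXY
    + Real.cos (3 * θ t) * (a * d - b * c) * Real.sin_sq_add_cos_sq t
end

section
/- Let a, b, c, d be real numbers and define p, q : ℝ → ℝ by p(t) = P(cos t, sin t) and q(t) = Q(cos t, sin t), where P(x,y) = (ax + by)(x³ − 3xy²) + (cx + dy)(y³ − 3x²y) and Q(x,y) = −(ax + by)(y³ − 3x²y) + (cx + dy)(x³ − 3xy²). If t₀ ∈ ℝ satisfies p(t₀) = 0, then q(t₀) · (p'(t₀) + 3·q(t₀)) = bc − ad. -/
/-- Elliptic characteristic polynomial P. -/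
def ellP (a b c d x y : ℝ) : ℝ :=
  (a*x + b*y) * (x^3 - 3*x*y^2) + (c*x + d*y) * (y^3 - 3*x^2*y)

/-- Elliptic characteristic polynomial Q. -/
def ellQ (a b c d x y : ℝ) : ℝ :=
  -(a*x + b*y) * (y^3 - 3*x^2*y) + (c*x + d*y) * (x^3 - 3*x*y^2)

/-- On the unit circle the derivative of `t ↦ ellP a b c d (cos t) (sin t)` differs from
`-3 * ellQ a b c d (cos t) (sin t)` only by the derivative of the linear factors. -/
theorem hasDerivAt_ellP_cos_sin (a b c d t : ℝ) :
    HasDerivAt (fun s => ellP a b c d (Real.cos s) (Real.sin s))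
      ((b * Real.cos t - a * Real.sin t) * (Real.cos t ^ 3 - 3 * Real.cos t * Real.sin t ^ 2)
        + (d * Real.cos t - c * Real.sin t) * (Real.sin t ^ 3 - 3 * Real.cos t ^ 2 * Real.sin t)
        - 3 * ellQ a b c d (Real.cos t) (Real.sin t)) t := by
  have hx := Real.hasDerivAt_cos t
  have hy := Real.hasDerivAt_sin t
  have hA := (hx.const_mul a).add (hy.const_mul b)
  have hB := (hx.const_mul c).add (hy.const_mul d)
  have hu := (hx.pow 3).sub ((hx.const_mul 3).mul (hy.pow 2))
  have hv := (hy.pow 3).sub (((hx.pow 2).const_mul 3).mul hy)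
  refine ((hA.mul hu).add (hB.mul hv)).congr_deriv ?_
  simp only [ellQ, Pi.add_apply, Pi.sub_apply, Pi.mul_apply, Pi.pow_apply]
  push_cast
  ring

theorem elliptic_saddle_identity (a b c d : ℝ)
    (p q : ℝ → ℝ)
    (hp : ∀ t, p t = ellP a b c d (Real.cos t) (Real.sin t))
    (hq : ∀ t, q t = ellQ a b c d (Real.cos t) (Real.sin t))
    (t₀ : ℝ) (ht₀ : p t₀ = 0) :
    q t₀ * (deriv p t₀ + 3 * q t₀) = b*c - a*d := by
  have hderiv := (hasDerivAt_ellP_cos_sin a b c d t₀).deriv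
  rw [← funext hp, ← hq] at hderiv
  rw [hderiv, sub_add_cancel, hq]
  rw [hp] at ht₀
  have hxy := Real.cos_sq_add_sin_sq t₀
  unfold ellP at ht₀
  unfold ellQ
  generalize Real.cos t₀ = x at *
  generalize Real.sin t₀ = y at *
  have hpow : (x ^ 2 + y ^ 2) ^ 4 = 1 := by rw [hxy, one_pow]
  linear_combination (b * c - a * d) * hpow +
    ((d * x - c * y) * (x ^ 3 - 3 * x * y ^ 2)
      - (b * x - a * y) * (y ^ 3 - 3 * x ^ 2 * y)) * ht₀
end

section
/- Let a, b, c, d be real numbers with ad − bc ≠ 0 and ad ≠ 0. Define P(x,y) = (ax + by)x³ + (cx + dy)y³ and Q(x,y) = xy·((ax + by)x − (cx + dy)y). Then P and Q have no common zero other than (0,0); that is, for every (x,y) ≠ (0,0), (P(x,y), Q(x,y)) ≠ (0,0). -/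
/-- Hyperbolic characteristic polynomial P. -/
def hypP (a b c d x y : ℝ) : ℝ := (a*x + b*y) * x^3 + (c*x + d*y) * y^3

/-- Hyperbolic characteristic polynomial Q. -/
def hypQ (a b c d x y : ℝ) : ℝ := x * y * ((a*x + b*y) * x - (c*x + d*y) * y)

theorem hypPQ_no_common_zero (a b c d : ℝ)
    (hdet : a*d - b*c ≠ 0) (had : a*d ≠ 0) :
    ∀ x y : ℝ, (x, y) ≠ ((0 : ℝ), (0 : ℝ)) →
      (hypP a b c d x y, hypQ a b c d x y) ≠ ((0 : ℝ), (0 : ℝ)) := by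
  intro x y hxy h
  obtain ⟨hP, hQ⟩ := Prod.mk.inj h
  unfold hypP at hP
  unfold hypQ at hQ
  have ha : a ≠ 0 := left_ne_zero_of_mul had
  have hd : d ≠ 0 := right_ne_zero_of_mul had
  by_cases hx : x = 0
  · subst hx
    have hy : y ≠ 0 := fun hy => hxy (by rw [hy])
    exact mul_ne_zero hd (pow_ne_zero 4 hy) (by linear_combination hP)
  by_cases hy : y = 0
  · subst hy
    exact mul_ne_zero ha (pow_ne_zero 4 hx) (by linear_combination hP)
  have hUV : (a*x + b*y) * x - (c*x + d*y) * y = 0 :=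
    (mul_eq_zero.mp hQ).resolve_left (mul_ne_zero hx hy)
  have hsq : x^2 + y^2 ≠ 0 := by positivity
  have hV : c*x + d*y = 0 := by
    have hmul : (c*x + d*y) * (y * (x^2 + y^2)) = 0 := by
      linear_combination hP - x^2 * hUV
    exact (mul_eq_zero.mp hmul).resolve_right (mul_ne_zero hy hsq)
  have hU : a*x + b*y = 0 := by
    have hmul : (a*x + b*y) * x = 0 := by linear_combination hUV + y * hV
    exact (mul_eq_zero.mp hmul).resolve_right hx
  exact mul_ne_zero hdet hx (by linear_combination d * hU - b * hV)
end

section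
/- Let a, b, c, d be real numbers and define p, q : ℝ → ℝ by p(t) = (a cos t + b sin t)cos³t + (c cos t + d sin t)sin³t and q(t) = cos t · sin t · ((a cos t + b sin t)cos t − (c cos t + d sin t)sin t). If t₀ ∈ ℝ satisfies p(t₀) = 0 and a cos t₀ + b sin t₀ ≠ 0, then (a cos t₀ + b sin t₀)·(p'(t₀) + 3·q(t₀)) = (ad − bc)·sin³t₀. -/
theorem hyperbolic_saddle_identity (a b c d : ℝ)
    (p q : ℝ → ℝ)
    (hp : ∀ t, p t = (a * Real.cos t + b * Real.sin t) * (Real.cos t)^3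
        + (c * Real.cos t + d * Real.sin t) * (Real.sin t)^3)
    (hq : ∀ t, q t = Real.cos t * Real.sin t *
        ((a * Real.cos t + b * Real.sin t) * Real.cos t
          - (c * Real.cos t + d * Real.sin t) * Real.sin t))
    (t₀ : ℝ) (ht₀ : p t₀ = 0)
    (hab : a * Real.cos t₀ + b * Real.sin t₀ ≠ 0) :
    (a * Real.cos t₀ + b * Real.sin t₀) * (deriv p t₀ + 3 * q t₀)
      = (a*d - b*c) * (Real.sin t₀)^3 := by
  have hlin (u v : ℝ) : HasDerivAt (fun t => u * Real.cos t + v * Real.sin t)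
      (u * -Real.sin t₀ + v * Real.cos t₀) t₀ :=
    ((Real.hasDerivAt_cos t₀).const_mul u).add ((Real.hasDerivAt_sin t₀).const_mul v)
  have hderiv := ((hlin a b).fun_mul ((Real.hasDerivAt_cos t₀).fun_pow 3)).fun_add
    ((hlin c d).fun_mul ((Real.hasDerivAt_sin t₀).fun_pow 3))
  rw [← funext hp] at hderiv
  rw [hderiv.deriv, hq]
  rw [hp] at ht₀
  push_cast
  linear_combination (-a * Real.sin t₀ + b * Real.cos t₀) * ht₀
    + (a * d - b * c) * Real.sin t₀ ^ 3 * Real.sin_sq_add_cos_sq t₀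
end

section
/- Let a, h be real numbers and define P(x,y) = a·x⁴ + (2 − 2h)·x³y − (2 + 2h)·x·y³ − a·y⁴. If 27a²h² < (1 − a² − h²)³ (i.e., (a,h) is inside the astroid), then the set {θ ∈ [0, π) : P(cos θ, sin θ) = 0} has exactly 4 elements. If 27a²h² > (1 − a² − h²)³ (i.e., (a,h) is outside the astroid), then this set has exactly 2 elements. -/
/-- The discriminant of a quartic with two prescribed roots `r`, `s`, in terms of the complementary
quadratic factor `a x² + β x + γ`. -/
theorem quartic_discrim_factor (a β γ r s A B C D E : ℝ) (hA : A = a)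
    (hB : B = β - a * (r + s)) (hC : C = γ - (r + s) * β + r * s * a)
    (hD : D = r * s * β - (r + s) * γ) (hE : E = r * s * γ) :
    256 * A^3 * E^3 - 192 * A^2 * B * D * E^2 - 128 * A^2 * C^2 * E^2 + 144 * A^2 * C * D^2 * E
      - 27 * A^2 * D^4 + 144 * A * B^2 * C * E^2 - 6 * A * B^2 * D^2 * E - 80 * A * B * C^2 * D * E
      + 18 * A * B * C * D^3 + 16 * A * C^4 * E - 4 * A * C^3 * D^2 - 27 * B^4 * E^2
      + 18 * B^3 * C * D * E - 4 * B^3 * D^3 - 4 * B^2 * C^3 * E + B^2 * C^2 * D^2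
    = discrim a β γ *
        ((r - s) * (a * r^2 + β * r + γ) * (a * s^2 + β * s + γ))^2 := by
  subst hA hB hC hD hE
  unfold discrim
  ring

theorem exists_pos_root_quartic (b c : ℝ) : ∃ r : ℝ, 0 < r ∧ r^4 + b * r^3 + c * r - 1 = 0 := by
  have hb := abs_nonneg b
  have hc := abs_nonneg c
  set M := 1 + |b| + |c| with hM
  have hM1 : 1 ≤ M := by linarith
  have hM3 : M ≤ M^3 := by nlinarith [mul_nonneg (sub_nonneg.2 hM1) (sub_nonneg.2 hM1)]
  have hpos : 0 ≤ M^4 + b * M^3 + c * M - 1 := by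
    have h1 : 0 ≤ (b + |b|) * M^3 :=
      mul_nonneg (by linarith [neg_abs_le b]) (by positivity)
    have h2 : 0 ≤ (c + |c|) * M :=
      mul_nonneg (by linarith [neg_abs_le c]) (by positivity)
    have h3 : 0 ≤ |c| * (M^3 - M) := mul_nonneg hc (by linarith)
    have h4 : M^4 = (1 + |b| + |c|) * M^3 := by rw [← hM]; ring
    nlinarith
  obtain ⟨r, hr, hr0⟩ := intermediate_value_Icc (f := fun x : ℝ => x^4 + b * x^3 + c * x - 1)
    (by linarith : (0 : ℝ) ≤ M) (by fun_prop)
    (show (0 : ℝ) ∈ Set.Icc _ _ from ⟨by norm_num, hpos⟩)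
  refine ⟨r, lt_of_le_of_ne hr.1 ?_, hr0⟩
  rintro rfl
  norm_num at hr0

theorem exists_quartic_factorization (a b c : ℝ) (ha : a ≠ 0) :
    ∃ r s β γ : ℝ, s < r ∧ b = β - a * (r + s) ∧ 0 = γ - (r + s) * β + r * s * a ∧
      c = r * s * β - (r + s) * γ ∧ -a = r * s * γ := by
  obtain ⟨r, hr, hr0⟩ := exists_pos_root_quartic (b / a) (c / a)
  obtain ⟨t, ht, ht0⟩ := exists_pos_root_quartic (-(b / a)) (-(c / a))
  have hbr : a * r^4 + b * r^3 + c * r - a = 0 := by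
    field_simp at hr0; linear_combination hr0
  have hbt : a * t^4 - b * t^3 - c * t - a = 0 := by
    field_simp at ht0; linear_combination ht0
  have hrt : r + t ≠ 0 := by positivity
  refine ⟨r, -t, b + a * (r - t), (r - t) * b + a * ((r - t)^2 + r * t), by linarith, by ring,
    by ring, ?_, ?_⟩
  · apply mul_left_cancel₀ hrt
    linear_combination hbr - hbt
  · apply mul_left_cancel₀ hrt
    linear_combination t * hbr + r * hbt

/-- The number of real roots of a quartic of this shape is governed by the sign of its
discriminant. -/
theorem ncard_quartic_roots (a h : ℝ) (ha : a ≠ 0) :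
    (27*a^2*h^2 < (1 - a^2 - h^2)^3 →
      {u : ℝ | a*u^4 + (2 - 2*h)*u^3 - (2 + 2*h)*u - a = 0}.ncard = 4) ∧
    (27*a^2*h^2 > (1 - a^2 - h^2)^3 →
      {u : ℝ | a*u^4 + (2 - 2*h)*u^3 - (2 + 2*h)*u - a = 0}.ncard = 2) := by
  obtain ⟨r, s, β, γ, hsr, hb, h0, hc, he⟩ :=
    exists_quartic_factorization a (2 - 2*h) (-(2 + 2*h)) ha
  have hdisc := quartic_discrim_factor a β γ r s _ _ _ _ _ rfl hb h0 hc he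
  have hdisc' : 256 * ((1 - a^2 - h^2)^3 - 27*a^2*h^2) = discrim a β γ *
      ((r - s) * (a * r^2 + β * r + γ) * (a * s^2 + β * s + γ))^2 := by
    rw [← hdisc]; ring
  have hfac : ∀ u : ℝ, a*u^4 + (2 - 2*h)*u^3 - (2 + 2*h)*u - a = 0 ↔
      u = r ∨ u = s ∨ a * (u * u) + β * u + γ = 0 := by
    intro u
    have : a*u^4 + (2 - 2*h)*u^3 - (2 + 2*h)*u - a
        = (u - r) * ((u - s) * (a * (u * u) + β * u + γ)) := by
      linear_combination u^3 * hb + u^2 * h0 + u * hc + he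
    rw [this, mul_eq_zero, mul_eq_zero, sub_eq_zero, sub_eq_zero]
  constructor
  · intro hlt
    have hpos : 0 < discrim a β γ *
        ((r - s) * (a * r^2 + β * r + γ) * (a * s^2 + β * s + γ))^2 := by linarith
    have hd : 0 < discrim a β γ := pos_of_mul_pos_left hpos (sq_nonneg _)
    have hne := (pow_ne_zero_iff two_ne_zero).1 (right_ne_zero_of_mul hpos.ne')
    have hQr : a * (r * r) + β * r + γ ≠ 0 := by
      have := right_ne_zero_of_mul (left_ne_zero_of_mul hne)
      rwa [sq] at this
    have hQs : a * (s * s) + β * s + γ ≠ 0 := by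
      have := right_ne_zero_of_mul hne
      rwa [sq] at this
    have hq := fun u => quadratic_eq_zero_iff ha (Real.mul_self_sqrt hd.le).symm u
    have hsq := Real.sqrt_pos.2 hd
    generalize √(discrim a β γ) = w at hq hsq
    have hxy : (-β + w) / (2 * a) ≠ (-β - w) / (2 * a) := by
      intro hxy
      rw [div_left_inj' (mul_ne_zero two_ne_zero ha)] at hxy
      linarith
    rw [Ne, hq, not_or] at hQr hQs
    have hset : {u : ℝ | a*u^4 + (2 - 2*h)*u^3 - (2 + 2*h)*u - a = 0}
        = ({r, s, (-β + w) / (2 * a), (-β - w) / (2 * a)} : Finset ℝ) := by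
      ext u
      simp [hfac, hq]
    rw [hset, Set.ncard_coe_finset]
    simp [Finset.card_insert_of_notMem, hsr.ne', hQr.1, hQr.2, hQs.1, hQs.2, hxy]
  · intro hgt
    have hd : discrim a β γ < 0 := by
      by_contra! hd
      have := mul_nonneg hd
        (sq_nonneg ((r - s) * (a * r^2 + β * r + γ) * (a * s^2 + β * s + γ)))
      linarith
    have hq : ∀ u, a * (u * u) + β * u + γ ≠ 0 :=
      quadratic_ne_zero_of_discrim_ne_sq fun t ht => by nlinarith [sq_nonneg t]
    have hset : {u : ℝ | a*u^4 + (2 - 2*h)*u^3 - (2 + 2*h)*u - a = 0} = {r, s} := by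
      ext u
      simp [hfac, hq]
    rw [hset, Set.ncard_pair hsr.ne']

theorem ncard_cubic_roots (h : ℝ) :
    (h^2 < 1 → {u : ℝ | (2 - 2*h)*u^3 - (2 + 2*h)*u = 0}.ncard = 3) ∧
    (1 < h^2 → {u : ℝ | (2 - 2*h)*u^3 - (2 + 2*h)*u = 0}.ncard = 1) := by
  constructor
  · intro hh
    obtain ⟨h1, h2⟩ := abs_lt.1 ((sq_lt_one_iff_abs_lt_one h).1 hh)
    have hk : 0 < (1 + h) / (1 - h) := div_pos (by linarith) (by linarith)
    have hk0 := Real.sqrt_pos.2 hk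
    have hk2 := Real.sq_sqrt hk.le
    generalize √((1 + h) / (1 - h)) = k at hk0 hk2
    have hk3 : (1 - h) * k^2 = 1 + h := by
      rw [hk2, mul_div_cancel₀]; linarith
    have hset : {u : ℝ | (2 - 2*h)*u^3 - (2 + 2*h)*u = 0} = {0, k, -k} := by
      ext u
      have : (2 - 2*h)*u^3 - (2 + 2*h)*u = 2 * (1 - h) * (u * ((u - k) * (u - -k))) := by
        linear_combination 2 * u * hk3
      have h3 : 2 * (1 - h) ≠ 0 := by linarith
      rw [Set.mem_ofPred_eq, this, mul_eq_zero_iff_left h3]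
      simp only [mul_eq_zero, sub_eq_zero,
        Set.mem_insert_iff, Set.mem_singleton_iff]
    rw [hset, Set.ncard_eq_three]
    exact ⟨0, k, -k, hk0.ne, by linarith, by linarith, rfl⟩
  · intro hh
    rw [Set.ncard_eq_one]
    refine ⟨0, Set.ext fun u => ?_⟩
    simp only [Set.mem_ofPred_eq, Set.mem_singleton_iff]
    refine ⟨fun hu => ?_, fun hu => by rw [hu]; ring⟩
    by_contra hu0
    have h1 : (1 - h) * u^2 = 1 + h := by
      apply mul_left_cancel₀ hu0
      linear_combination hu / 2
    nlinarith [mul_nonneg (sq_nonneg (1 - h)) (sq_nonneg u)]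

/-- The angles in `(0, π)` at which a function of the cotangent vanishes are counted by the zeros
of that function. -/
theorem ncard_angle_eq (q : ℝ → ℝ) (f : ℝ → ℝ)
    (hf : ∀ u, f (Real.pi / 2 - Real.arctan u) = 0 ↔ q u = 0) :
    {θ : ℝ | θ ∈ Set.Ioo 0 Real.pi ∧ f θ = 0}.ncard = {u : ℝ | q u = 0}.ncard := by
  have hinj : Function.Injective fun u : ℝ => Real.pi / 2 - Real.arctan u := fun u v huv =>
    Real.arctan_injective (sub_right_injective huv)
  rw [← Set.ncard_image_of_injective {u : ℝ | q u = 0} hinj]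
  congr 1
  ext θ
  constructor
  · rintro ⟨⟨h0, hpi⟩, hθ⟩
    have hu : Real.pi / 2 - Real.arctan (Real.tan (Real.pi / 2 - θ)) = θ := by
      rw [Real.arctan_tan (by linarith) (by linarith)]; ring
    exact ⟨Real.tan (Real.pi / 2 - θ), (hf _).1 (by rwa [hu]), hu⟩
  · rintro ⟨u, hu, rfl⟩
    have h1 := Real.arctan_lt_pi_div_two u
    have h2 := Real.neg_pi_div_two_lt_arctan u
    exact ⟨⟨by linarith, by linarith⟩, (hf u).2 hu⟩

theorem elliptic_root_count_astroid (a h : ℝ)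
    (P : ℝ → ℝ → ℝ)
    (hP : ∀ x y : ℝ, P x y = a*x^4 + (2 - 2*h)*x^3*y - (2 + 2*h)*x*y^3 - a*y^4) :
    (27*a^2*h^2 < (1 - a^2 - h^2)^3 →
      {θ : ℝ | θ ∈ Set.Ico 0 Real.pi ∧ P (Real.cos θ) (Real.sin θ) = 0}.ncard = 4) ∧
    (27*a^2*h^2 > (1 - a^2 - h^2)^3 →
      {θ : ℝ | θ ∈ Set.Ico 0 Real.pi ∧ P (Real.cos θ) (Real.sin θ) = 0}.ncard = 2) := by
  have hIoo := ncard_angle_eq (fun u => a*u^4 + (2 - 2*h)*u^3 - (2 + 2*h)*u - a)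
    (fun θ => P (Real.cos θ) (Real.sin θ)) (by
      intro u
      have hcos := Real.cos_arctan_pos u
      have hsin : Real.sin (Real.arctan u) = u * Real.cos (Real.arctan u) := by
        conv_rhs => rw [← Real.tan_arctan u, Real.arctan_tan
          (Real.neg_pi_div_two_lt_arctan u) (Real.arctan_lt_pi_div_two u)]
        exact (Real.tan_mul_cos hcos.ne').symm
      simp only [Real.cos_pi_div_two_sub, Real.sin_pi_div_two_sub, hP, hsin]
      generalize Real.cos (Real.arctan u) = w at hcos
      rw [show a * (u * w)^4 + (2 - 2*h) * (u * w)^3 * w - (2 + 2*h) * (u * w) * w^3 - a * w^4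
        = w^4 * (a*u^4 + (2 - 2*h)*u^3 - (2 + 2*h)*u - a) by ring]
      simp [hcos.ne'])
  have hP0 : P (Real.cos 0) (Real.sin 0) = a := by simp [hP]
  by_cases ha : a = 0
  · subst ha
    have hcub := ncard_cubic_roots h
    simp only [zero_mul, zero_add, sub_zero] at hIoo
    have hset : {θ : ℝ | θ ∈ Set.Ico 0 Real.pi ∧ P (Real.cos θ) (Real.sin θ) = 0}
        = insert 0 {θ : ℝ | θ ∈ Set.Ioo 0 Real.pi ∧ P (Real.cos θ) (Real.sin θ) = 0} := by
      ext θ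
      rcases eq_or_ne θ 0 with rfl | hθ
      · simp [hP0, Real.pi_pos, -Real.cos_zero, -Real.sin_zero]
      · simp [hθ, le_iff_lt_or_eq, hθ.symm]
    have hcard (n : ℕ) (hn : {u : ℝ | (2 - 2*h)*u^3 - (2 + 2*h)*u = 0}.ncard = n + 1) :
        {θ : ℝ | θ ∈ Set.Ico 0 Real.pi ∧ P (Real.cos θ) (Real.sin θ) = 0}.ncard = n + 2 := by
      rw [hn] at hIoo
      rw [hset, Set.ncard_insert_of_notMem (by simp)
        (Set.finite_of_ncard_ne_zero (by omega)), hIoo]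
    constructor
    · intro hlt
      refine hcard 2 (hcub.1 ?_)
      by_contra! hh
      nlinarith [pow_nonneg (sub_nonneg.2 hh) 3]
    · intro hgt
      refine hcard 0 (hcub.2 ?_)
      by_contra! hh
      nlinarith [pow_nonneg (sub_nonneg.2 hh) 3]
  · have hset : {θ : ℝ | θ ∈ Set.Ico 0 Real.pi ∧ P (Real.cos θ) (Real.sin θ) = 0}
        = {θ : ℝ | θ ∈ Set.Ioo 0 Real.pi ∧ P (Real.cos θ) (Real.sin θ) = 0} := by
      ext θ
      rcases eq_or_ne θ 0 with rfl | hθ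
      · simp [hP0, ha, -Real.cos_zero, -Real.sin_zero]
      · simp [le_iff_lt_or_eq, hθ.symm]
    rw [hset, hIoo]
    exact ncard_quartic_roots a h ha
end

section
/- Let a, d be real numbers and define P(x,y) = a·x⁴ + 4·x³y + 4·x·y³ + d·y⁴ and Δ = (ad − 4)³ − 27(a + d)². If Δ > 0, then P(x,y) ≠ 0 for every (x,y) ≠ (0,0). If Δ < 0, then the set {θ ∈ [0, π) : P(cos θ, sin θ) = 0} has exactly 2 elements. -/
open Set

/-- For `a > 0` the quartic `a t⁴ + 4 t³ + 4 t + d` has a single critical point `-r`. Its value `e`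
there has the sign of the discriminant, and the quartic exceeds `e` at least quadratically. -/
theorem exists_min_quartic {a : ℝ} (ha : 0 < a) (d : ℝ) :
    ∃ r e c : ℝ, 0 < r ∧ 0 < c ∧ a * r ^ 3 = 3 * r ^ 2 + 1 ∧
      (0 < (a * d - 4) ^ 3 - 27 * (a + d) ^ 2 → 0 < e) ∧
      ((a * d - 4) ^ 3 - 27 * (a + d) ^ 2 < 0 → e < 0) ∧
      a * (-r) ^ 4 + 4 * (-r) ^ 3 + 4 * (-r) + d = e ∧
      ∀ t : ℝ, e + c * (t + r) ^ 2 ≤ a * t ^ 4 + 4 * t ^ 3 + 4 * t + d := by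
  obtain ⟨r, hr, hr0⟩ : ∃ r : ℝ, a * r ^ 3 - 3 * r ^ 2 - 1 = 0 ∧ 0 < r := by
    have hM : (0 : ℝ) ≤ 1 + 4 / a := by positivity
    have hc : ContinuousOn (fun r : ℝ => a * r ^ 3 - 3 * r ^ 2 - 1) (Icc 0 (1 + 4 / a)) := by
      fun_prop
    have h := intermediate_value_Icc hM hc
    have hmem : (0 : ℝ) ∈ Icc (a * 0 ^ 3 - 3 * 0 ^ 2 - 1)
        (a * (1 + 4 / a) ^ 3 - 3 * (1 + 4 / a) ^ 2 - 1) := by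
      refine ⟨by norm_num, ?_⟩
      have h1 : a * (1 + 4 / a) ^ 3 - 3 * (1 + 4 / a) ^ 2 - 1
          = (1 + 4 / a) ^ 2 * (a + 1) - 1 := by
        field_simp
        ring
      have h2 : 0 < 4 / a := by positivity
      rw [h1]
      nlinarith [mul_pos h2 h2, mul_pos h2 ha]
    obtain ⟨r, hr, h0⟩ := h hmem
    refine ⟨r, h0, lt_of_le_of_ne hr.1 ?_⟩
    rintro rfl
    norm_num at h0
  have hra : a = (3 * r ^ 2 + 1) / r ^ 3 := by
    field_simp
    linarith
  obtain ⟨e, rfl⟩ : ∃ e, d = e + (r ^ 3 + 3 * r) := ⟨d - (r ^ 3 + 3 * r), by ring⟩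
  obtain ⟨w, hw⟩ : ∃ w, w = (r ^ 2 + 1) / r := ⟨_, rfl⟩
  have h1 : a * (r ^ 3 + 3 * r) - 4 = 3 * w ^ 2 := by
    rw [hra, hw]
    field_simp
    ring
  have h2 : a + (r ^ 3 + 3 * r) = w ^ 3 := by
    rw [hra, hw]
    field_simp
    ring
  have hq : 3 < w * a := by
    have : w * a - 3 = (4 * r ^ 2 + 1) / r ^ 4 := by
      rw [hra, hw]
      field_simp
      ring
    have : 0 < w * a - 3 := by rw [this]; positivity
    linarith
  obtain ⟨Q, hQ⟩ : ∃ Q, Q = 27 * w ^ 3 * (w * a - 2) + 9 * e * (w ^ 2 * a ^ 2 - 3)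
    + a ^ 3 * e ^ 2 := ⟨_, rfl⟩
  have hΔ : (a * (e + (r ^ 3 + 3 * r)) - 4) ^ 3 - 27 * (a + (e + (r ^ 3 + 3 * r))) ^ 2
      = e * Q := by
    have e1 : a * (e + (r ^ 3 + 3 * r)) - 4 = 3 * w ^ 2 + a * e := by linarith
    have e2 : a + (e + (r ^ 3 + 3 * r)) = w ^ 3 + e := by linarith
    rw [e1, e2, hQ]
    ring
  have hQ0 : 0 < Q := by
    have h4 : 4 * a ^ 3 * Q = (2 * a ^ 3 * e + 9 * ((w * a) ^ 2 - 3)) ^ 2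
        + 27 * (w * a - 3) ^ 3 * (w * a + 1) := by
      rw [hQ]
      ring
    have h5 : 0 < w * a - 3 := by linarith
    have h6 : 0 < w * a + 1 := by linarith
    have h7 : 0 < 4 * a ^ 3 * Q := by rw [h4]; positivity
    exact pos_of_mul_pos_right h7 (by positivity)
  refine ⟨r, e, 2 * (r ^ 4 + 4 * r ^ 2 + 1) / (r * (3 * r ^ 2 + 1)), hr0, by positivity, by linarith, ?_, ?_, ?_, ?_⟩
  · rw [hΔ]
    exact fun h => pos_of_mul_pos_left h hQ0.le
  · rw [hΔ]
    exact fun h => by_contra fun h' => h.not_ge (mul_nonneg (not_lt.1 h') hQ0.le)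
  · rw [hra]
    field_simp
    ring
  · intro t
    have : a * t ^ 4 + 4 * t ^ 3 + 4 * t + (e + (r ^ 3 + 3 * r))
        - (e + 2 * (r ^ 4 + 4 * r ^ 2 + 1) / (r * (3 * r ^ 2 + 1)) * (t + r) ^ 2)
        = (t + r) ^ 2 * (((3 * r ^ 2 + 1) * t - r * (r ^ 2 + 1)) ^ 2
          / (r ^ 3 * (3 * r ^ 2 + 1))) := by
      rw [hra]
      field_simp
      ring
    have h8 : 0 ≤ (t + r) ^ 2 * (((3 * r ^ 2 + 1) * t - r * (r ^ 2 + 1)) ^ 2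
          / (r ^ 3 * (3 * r ^ 2 + 1))) := by positivity
    linarith

theorem quartic_roots_ncard_of_pos {a d : ℝ} (ha : 0 < a)
    (hΔ : (a * d - 4) ^ 3 - 27 * (a + d) ^ 2 < 0) :
    {t : ℝ | a * t ^ 4 + 4 * t ^ 3 + 4 * t + d = 0}.ncard = 2 := by
  obtain ⟨r, e, c, hr, hc, har, -, he, hre, hlow⟩ := exists_min_quartic ha d
  have he := he hΔ
  set f : ℝ → ℝ := fun t => a * t ^ 4 + 4 * t ^ 3 + 4 * t + d with hf
  have hcont : Continuous f := by fun_prop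
  have hderiv : ∀ t, deriv f t = 4 * ((t + r) *
      (a * (t - 1 / (2 * a * r ^ 2)) ^ 2 + (12 * r ^ 2 + 3) / (4 * a * r ^ 4))) := by
    intro t
    have h : HasDerivAt f (a * (4 * t ^ 3) + 4 * (3 * t ^ 2) + 4) t := by
      have h4 := (hasDerivAt_pow 4 t).const_mul a
      have h3 := (hasDerivAt_pow 3 t).const_mul 4
      have h1 := (hasDerivAt_id t).const_mul 4
      refine (((h4.add h3).add h1).add_const d).congr_deriv ?_
      norm_num
    rw [h.deriv]
    have hra : a = (3 * r ^ 2 + 1) / r ^ 3 := by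
      field_simp
      linarith
    rw [hra]
    field_simp
    ring
  have hpos : ∀ t, 0 < a * (t - 1 / (2 * a * r ^ 2)) ^ 2
      + (12 * r ^ 2 + 3) / (4 * a * r ^ 4) := fun t => by positivity
  have hmono : StrictMonoOn f (Ici (-r)) := by
    refine strictMonoOn_of_deriv_pos (convex_Ici _) hcont.continuousOn fun t ht => ?_
    rw [interior_Ici, mem_Ioi] at ht
    rw [hderiv]
    have := mul_pos (show 0 < t + r by linarith) (hpos t)
    linarith
  have hanti : StrictAntiOn f (Iic (-r)) := by
    refine strictAntiOn_of_deriv_neg (convex_Iic _) hcont.continuousOn fun t ht => ?_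
    rw [interior_Iic, mem_Iio] at ht
    rw [hderiv]
    have := mul_neg_of_neg_of_pos (show t + r < 0 by linarith) (hpos t)
    linarith
  have hmin : f (-r) < 0 := by
    simp only [hf]
    linarith
  obtain ⟨s, hs, hcs⟩ : ∃ s : ℝ, 0 ≤ s ∧ c * s ^ 2 = -e := by
    refine ⟨√(-e / c), Real.sqrt_nonneg _, ?_⟩
    rw [Real.sq_sqrt (by have := neg_pos.2 he; positivity)]
    field_simp
  have hR : 0 ≤ f (-r + s) := by
    have h := hlow (-r + s)
    rw [show -r + s + r = s by ring, hcs] at h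
    simp only [hf]
    linarith
  have hL : 0 ≤ f (-r - s) := by
    have h := hlow (-r - s)
    rw [show -r - s + r = -s by ring, neg_sq, hcs] at h
    simp only [hf]
    linarith
  obtain ⟨u, hu, hfu⟩ := intermediate_value_Icc' (show -r - s ≤ -r by linarith)
    hcont.continuousOn ⟨hmin.le, hL⟩
  obtain ⟨v, hv, hfv⟩ := intermediate_value_Icc (show -r ≤ -r + s by linarith)
    hcont.continuousOn ⟨hmin.le, hR⟩
  have huv : u ≠ v := by
    rintro rfl
    rw [le_antisymm hu.2 hv.1] at hfu
    exact hmin.ne hfu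
  rw [ncard_eq_two]
  refine ⟨u, v, huv, ?_⟩
  ext t
  simp only [mem_ofPred_eq, mem_insert_iff, mem_singleton_iff]
  constructor
  · intro (ht : f t = 0)
    rcases le_total t (-r) with h | h
    · exact Or.inl (hanti.injOn h hu.2 (ht.trans hfu.symm))
    · exact Or.inr (hmono.injOn h hv.1 (ht.trans hfv.symm))
  · rintro (rfl | rfl)
    exacts [hfu, hfv]

theorem quartic_roots_ncard {a d : ℝ} (ha : a ≠ 0)
    (hΔ : (a * d - 4) ^ 3 - 27 * (a + d) ^ 2 < 0) :
    {t : ℝ | a * t ^ 4 + 4 * t ^ 3 + 4 * t + d = 0}.ncard = 2 := by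
  rcases ha.lt_or_gt with h | h
  · have h2 := quartic_roots_ncard_of_pos (a := -a) (d := -d) (by linarith)
      (by convert hΔ using 1; ring)
    refine Eq.trans ?_ h2
    rw [← ncard_image_of_injective _ neg_injective]
    congr 1
    ext t
    simp only [image_neg_eq_neg, mem_neg, mem_ofPred_eq]
    constructor <;> intro h <;> linarith
  · exact quartic_roots_ncard_of_pos h hΔ

theorem existsUnique_root_cubic (d : ℝ) : ∃! t : ℝ, 4 * t ^ 3 + 4 * t + d = 0 := by
  have hmono : StrictMono fun t : ℝ => 4 * t ^ 3 + 4 * t + d := by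
    have h : StrictMono fun t : ℝ => t ^ 3 := Odd.strictMono_pow (by decide)
    intro x y hxy
    have := h hxy
    simp only at this ⊢
    linarith
  have hcont : Continuous fun t : ℝ => 4 * t ^ 3 + 4 * t + d := by fun_prop
  obtain ⟨t, -, ht⟩ := intermediate_value_Icc (show -|d| ≤ |d| by linarith [abs_nonneg d])
    hcont.continuousOn (show (0 : ℝ) ∈ _ from by
      have h3 : 0 ≤ |d| ^ 3 := by positivity
      constructor
      · nlinarith [le_abs_self d, abs_nonneg d]
      · nlinarith [neg_abs_le d, abs_nonneg d])
  exact ⟨t, ht, fun s hs => hmono.injective (hs.trans ht.symm)⟩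

theorem quartic_form_ne_zero_of_pos {a d : ℝ} (ha : 0 < a)
    (hΔ : 0 < (a * d - 4) ^ 3 - 27 * (a + d) ^ 2) {x y : ℝ} (hxy : (x, y) ≠ (0, 0)) :
    a * x ^ 4 + 4 * x ^ 3 * y + 4 * x * y ^ 3 + d * y ^ 4 ≠ 0 := by
  obtain ⟨r, e, c, -, hc, -, he, -, -, hlow⟩ := exists_min_quartic ha d
  have he := he hΔ
  by_cases hy : y = 0
  · subst hy
    have hx : x ≠ 0 := fun h => hxy (by rw [h])
    have : 0 < a * x ^ 4 := by positivity
    linarith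
  · have h := hlow (x / y)
    have h1 : 0 < a * (x / y) ^ 4 + 4 * (x / y) ^ 3 + 4 * (x / y) + d := by
      have : 0 ≤ c * (x / y + r) ^ 2 := by positivity
      linarith
    have h2 : a * x ^ 4 + 4 * x ^ 3 * y + 4 * x * y ^ 3 + d * y ^ 4
        = y ^ 4 * (a * (x / y) ^ 4 + 4 * (x / y) ^ 3 + 4 * (x / y) + d) := by
      field_simp
    rw [h2]
    positivity

theorem injective_pi_div_two_sub_arctan :
    Function.Injective fun t : ℝ => Real.pi / 2 - Real.arctan t := fun s t h =>
  Real.arctan_injective (by simpa using h)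

/-- The zero directions in `[0, π)` of a binary quartic form: the direction `0` when `a = 0`,
and the directions with cotangent a root of the dehomogenized quartic. -/
theorem zero_directions_eq (a d : ℝ) :
    {θ : ℝ | θ ∈ Ico 0 Real.pi ∧ a * Real.cos θ ^ 4 + 4 * Real.cos θ ^ 3 * Real.sin θ
      + 4 * Real.cos θ * Real.sin θ ^ 3 + d * Real.sin θ ^ 4 = 0} =
    {θ : ℝ | θ = 0 ∧ a = 0} ∪ (fun t : ℝ => Real.pi / 2 - Real.arctan t) ''
      {t : ℝ | a * t ^ 4 + 4 * t ^ 3 + 4 * t + d = 0} := by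
  have key : ∀ t s c : ℝ, c = t * s → a * c ^ 4 + 4 * c ^ 3 * s + 4 * c * s ^ 3 + d * s ^ 4
      = s ^ 4 * (a * t ^ 4 + 4 * t ^ 3 + 4 * t + d) := by
    rintro t s _ rfl
    ring
  ext θ
  simp only [mem_ofPred_eq, mem_union, mem_image]
  constructor
  · rintro ⟨⟨h0, hpi⟩, h⟩
    rcases h0.eq_or_lt with rfl | h0
    · left
      simpa using h
    · right
      have hs : 0 < Real.sin θ := Real.sin_pos_of_pos_of_lt_pi h0 hpi
      refine ⟨Real.tan (Real.pi / 2 - θ), ?_, ?_⟩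
      · rw [key (Real.tan (Real.pi / 2 - θ)) _ _ ?_] at h
        · exact (mul_eq_zero.1 h).resolve_left (by positivity)
        · rw [Real.tan_eq_sin_div_cos, Real.sin_pi_div_two_sub, Real.cos_pi_div_two_sub]
          field_simp
      · rw [Real.arctan_tan (by linarith) (by linarith)]
        ring
  · rintro (⟨rfl, rfl⟩ | ⟨t, ht, rfl⟩)
    · simp [Real.pi_pos]
    · have h1 := Real.neg_pi_div_two_lt_arctan t
      have h2 := Real.arctan_lt_pi_div_two t
      refine ⟨⟨by linarith, by linarith⟩, ?_⟩
      rw [key t _ _ ?_, ht, mul_zero]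
      rw [Real.cos_pi_div_two_sub, Real.sin_pi_div_two_sub]
      exact (Real.tan_mul_cos (Real.cos_arctan_pos t).ne').symm.trans (by rw [Real.tan_arctan])

theorem hyperbolic_root_count_bc16 (a d : ℝ)
    (P : ℝ → ℝ → ℝ)
    (hP : ∀ x y : ℝ, P x y = a*x^4 + 4*x^3*y + 4*x*y^3 + d*y^4)
    (Δ : ℝ) (hΔ : Δ = (a*d - 4)^3 - 27*(a + d)^2) :
    (Δ > 0 → ∀ x y : ℝ, (x, y) ≠ ((0 : ℝ), (0 : ℝ)) → P x y ≠ 0) ∧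
    (Δ < 0 →
      {θ : ℝ | θ ∈ Set.Ico 0 Real.pi ∧ P (Real.cos θ) (Real.sin θ) = 0}.ncard = 2) := by
  subst hΔ
  simp only [hP]
  refine ⟨fun hΔ x y hxy => ?_, fun hΔ => ?_⟩
  · rcases lt_trichotomy a 0 with ha | rfl | ha
    · have h := quartic_form_ne_zero_of_pos (a := -a) (d := -d) (x := -x) (y := y)
        (by linarith) (by convert hΔ using 1; ring) (by simpa using hxy)
      contrapose! h
      linarith
    · nlinarith [sq_nonneg d]
    · exact quartic_form_ne_zero_of_pos ha hΔ hxy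
  · rw [zero_directions_eq]
    rcases eq_or_ne a 0 with rfl | ha
    · obtain ⟨t, ht, hu⟩ := existsUnique_root_cubic d
      have hroots : {t : ℝ | 0 * t ^ 4 + 4 * t ^ 3 + 4 * t + d = 0} = {t} := by
        ext s
        simp only [zero_mul, zero_add, mem_ofPred_eq, mem_singleton_iff]
        exact ⟨hu s, fun h => h ▸ ht⟩
      have hzero : {θ : ℝ | θ = 0 ∧ (0 : ℝ) = 0} = {0} := by simp
      rw [hroots, hzero, image_singleton, singleton_union]
      refine ncard_pair ?_
      exact (sub_pos.2 (Real.arctan_lt_pi_div_two t)).ne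
    · have hzero : {θ : ℝ | θ = 0 ∧ a = 0} = ∅ := by simp [ha]
      rw [hzero, empty_union, ncard_image_of_injective _ injective_pi_div_two_sub_arctan]
      exact quartic_roots_ncard ha hΔ
end

section
/- Let a, d be real numbers and define P(x,y) = a·x⁴ − 4·x³y + 4·x·y³ + d·y⁴ and Δ = (ad + 4)³ − 27(a + d)². If Δ < 0, then the set {θ ∈ [0, π) : P(cos θ, sin θ) = 0} has exactly 2 elements. -/
open Polynomial in
/-- A complex root of a real polynomial gives a real root or a real quadratic divisor. -/
theorem real_root_or_quadratic_dvd (p : ℝ[X]) (hp : 1 ≤ p.natDegree) :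
    (∃ r : ℝ, X - C r ∣ p) ∨ ∃ m n : ℝ, X ^ 2 + C m * X + C n ∣ p := by
  obtain ⟨z, hz⟩ := IsAlgClosed.exists_aeval_eq_zero ℂ p
    (natDegree_pos_iff_degree_pos.1 hp).ne'
  by_cases him : z.im = 0
  · refine Or.inl ⟨z.re, dvd_iff_isRoot.2 ?_⟩
    have hz' : z = algebraMap ℝ ℂ z.re := Complex.ext (by simp) (by simp [him])
    rw [hz', aeval_algebraMap_apply] at hz
    simpa using hz
  · refine Or.inr ⟨-(2 * z.re), ‖z‖ ^ 2, ?_⟩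
    have h := quadratic_dvd_of_aeval_eq_zero_im_ne_zero p hz him
    convert h using 1
    simp only [C_neg]
    ring

open Polynomial in
theorem exists_monic_quadratic_dvd (p : ℝ[X]) (hp : 2 ≤ p.natDegree) :
    ∃ m n : ℝ, X ^ 2 + C m * X + C n ∣ p := by
  rcases real_root_or_quadratic_dvd p (by omega) with ⟨r, q, rfl⟩ | h
  · have hq0 : q ≠ 0 := by
      rintro rfl
      simp at hp
    rw [natDegree_mul (X_sub_C_ne_zero r) hq0, natDegree_X_sub_C] at hp
    rcases real_root_or_quadratic_dvd q (by omega) with ⟨s, hs⟩ | ⟨m, n, h⟩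
    · refine ⟨-(r + s), r * s, ?_⟩
      have h := mul_dvd_mul_left (X - C r) hs
      convert h using 1
      simp only [C_neg, C_add, C_mul]
      ring
    · exact ⟨m, n, h.mul_left _⟩
  · exact h

open Polynomial in
/-- A binary quartic `a x⁴ + b x³ y + c x² y² + e x y³ + d y⁴` with `b ≠ 0` is a product of
two real quadratic forms, the first of which has leading coefficient one. -/
theorem exists_quartic_factorization_s14 (a b c e d : ℝ) (hb : b ≠ 0) :
    ∃ m n u v w : ℝ, u = a ∧ v + m * u = b ∧ w + m * v + n * u = c ∧
      m * w + n * v = e ∧ n * w = d := by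
  set p : ℝ[X] := C a * X ^ 4 + C b * X ^ 3 + C c * X ^ 2 + C e * X + C d with hp
  have hdeg : p.natDegree ≤ 4 := by rw [hp]; compute_degree
  have h3 : p.coeff 3 = b := by rw [hp]; simp
  have hdeg3 : 3 ≤ p.natDegree := le_natDegree_of_ne_zero (by rwa [h3])
  obtain ⟨m, n, q, hq⟩ := exists_monic_quadratic_dvd p (by omega)
  have hquad : (X ^ 2 + C m * X + C n : ℝ[X]).natDegree = 2 := by compute_degree!
  have hqdeg : q.natDegree ≤ 2 := by
    have hq0 : q ≠ 0 := by
      rintro rfl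
      simp [hq] at hdeg3
    rw [hq, natDegree_mul (by rintro h; simp [h] at hquad) hq0, hquad] at hdeg
    omega
  have hqe : q = C (q.coeff 2) * X ^ 2 + C (q.coeff 1) * X + C (q.coeff 0) := by
    conv_lhs => rw [as_sum_range' q 3 (by omega)]
    simp only [Finset.sum_range_succ, Finset.sum_range_zero, ← C_mul_X_pow_eq_monomial]
    ring
  generalize q.coeff 2 = u at hqe
  generalize q.coeff 1 = v at hqe
  generalize q.coeff 0 = w at hqe
  have key : p = C u * X ^ 4 + C (v + m * u) * X ^ 3 + C (w + m * v + n * u) * X ^ 2 +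
      C (m * w + n * v) * X + C (n * w) := by
    rw [hq, hqe]
    simp only [C_add, C_mul]
    ring
  rw [hp] at key
  have hc := fun k => congrArg (fun r : ℝ[X] => r.coeff k) key
  have h0 := hc 0
  have h1 := hc 1
  have h2 := hc 2
  have h3 := hc 3
  have h4 := hc 4
  simp only [coeff_add, coeff_C_mul, coeff_X_pow, coeff_X, coeff_C] at h0 h1 h2 h3 h4
  norm_num at h0 h1 h2 h3 h4
  exact ⟨m, n, u, v, w, h4.symm, h3.symm, h2.symm, h1.symm, h0.symm⟩

/-- A nonzero linear form vanishes on exactly one direction in `[0, π)`. -/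
theorem exists_direction_of_linear_form (u v : ℝ) (huv : u ≠ 0 ∨ v ≠ 0) :
    ∃ θ ∈ Set.Ico 0 Real.pi, ∀ τ ∈ Set.Ico 0 Real.pi,
      u * Real.cos τ + v * Real.sin τ = 0 ↔ τ = θ := by
  obtain ⟨θ, hθ, h0⟩ : ∃ θ ∈ Set.Ico 0 Real.pi, u * Real.cos θ + v * Real.sin θ = 0 := by
    by_cases hu : u = 0
    · exact ⟨0, ⟨le_rfl, Real.pi_pos⟩, by simp [hu]⟩
    · refine ⟨Real.arctan (v / u) + Real.pi / 2, ⟨?_, ?_⟩, ?_⟩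
      · linarith [Real.neg_pi_div_two_lt_arctan (v / u)]
      · linarith [Real.arctan_lt_pi_div_two (v / u)]
      · rw [Real.cos_add_pi_div_two, Real.sin_add_pi_div_two,
          ← Real.tan_mul_cos (Real.cos_arctan_pos (v / u)).ne', Real.tan_arctan]
        field_simp
        ring
  refine ⟨θ, hθ, fun τ hτ => ⟨fun h => ?_, fun h => h ▸ h0⟩⟩
  have hsin : Real.sin (τ - θ) = 0 := by
    rw [Real.sin_sub]
    rcases huv with hu | hv
    · refine (mul_eq_zero.1 ?_).resolve_left hu
      linear_combination Real.sin τ * h0 - Real.sin θ * h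
    · refine (mul_eq_zero.1 ?_).resolve_left hv
      linear_combination Real.cos θ * h - Real.cos τ * h0
  have := (Real.sin_eq_zero_iff_of_lt_of_lt (by linarith [hτ.1, hθ.2])
    (by linarith [hτ.2, hθ.1])).1 hsin
  linarith

theorem ncard_directions_of_mul_linear_forms (u v s t : ℝ) (h : u * t - v * s ≠ 0) :
    {θ : ℝ | θ ∈ Set.Ico 0 Real.pi ∧ (u * Real.cos θ + v * Real.sin θ) *
      (s * Real.cos θ + t * Real.sin θ) = 0}.ncard = 2 := by
  obtain ⟨α, hα, hα'⟩ := exists_direction_of_linear_form u v (by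
    by_contra! hc
    simp [hc.1, hc.2] at h)
  obtain ⟨β, hβ, hβ'⟩ := exists_direction_of_linear_form s t (by
    by_contra! hc
    simp [hc.1, hc.2] at h)
  have hne : α ≠ β := by
    rintro rfl
    have h1 := (hα' α hα).2 rfl
    have h2 := (hβ' α hα).2 rfl
    apply h
    linear_combination (-(u * t - v * s)) * Real.sin_sq_add_cos_sq α +
      (t * Real.cos α - s * Real.sin α) * h1 + (u * Real.sin α - v * Real.cos α) * h2
  rw [← Set.ncard_pair hne]
  congr 1
  ext θ
  simp only [Set.mem_ofPred_eq, Set.mem_insert_iff, Set.mem_singleton_iff, mul_eq_zero]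
  constructor
  · rintro ⟨hθ, h1 | h1⟩
    · exact Or.inl ((hα' θ hθ).1 h1)
    · exact Or.inr ((hβ' θ hθ).1 h1)
  · rintro (rfl | rfl)
    · exact ⟨hα, Or.inl ((hα' _ hα).2 rfl)⟩
    · exact ⟨hβ, Or.inr ((hβ' _ hβ).2 rfl)⟩

/-- An indefinite binary quadratic form vanishes on exactly two directions. -/
theorem ncard_directions_of_discrim_pos (A B C : ℝ) (h : 0 < discrim A B C) :
    {θ : ℝ | θ ∈ Set.Ico 0 Real.pi ∧ A * Real.cos θ ^ 2 + B * Real.cos θ * Real.sin θ +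
      C * Real.sin θ ^ 2 = 0}.ncard = 2 := by
  by_cases hA : A = 0
  · subst hA
    have hB : B ≠ 0 := by
      rintro rfl
      simp [discrim] at h
    refine Eq.trans ?_ (ncard_directions_of_mul_linear_forms 0 1 B C (by simpa using hB))
    congr! 5 with θ
    ring
  · have hD := Real.sq_sqrt h.le
    have hD0 := Real.sqrt_pos.2 h
    set D := √(discrim A B C)
    refine Eq.trans ?_ (ncard_directions_of_mul_linear_forms (2 * A) (B + D) (2 * A) (B - D)
      (fun hc => mul_ne_zero hA hD0.ne' (by linear_combination -hc / 4)))
    congr! 4 with θ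
    have key : (2 * A * Real.cos θ + (B + D) * Real.sin θ) *
        (2 * A * Real.cos θ + (B - D) * Real.sin θ) =
        4 * A * (A * Real.cos θ ^ 2 + B * Real.cos θ * Real.sin θ + C * Real.sin θ ^ 2) := by
      unfold discrim at hD
      linear_combination (-Real.sin θ ^ 2) * hD
    rw [key, mul_eq_zero_iff_left (mul_ne_zero four_ne_zero hA)]

/-- A definite binary quadratic form does not vanish away from the origin. -/
theorem quadratic_form_ne_zero_of_discrim_neg (A B C x y : ℝ) (h : discrim A B C < 0)
    (hxy : x ≠ 0 ∨ y ≠ 0) : A * x ^ 2 + B * x * y + C * y ^ 2 ≠ 0 := by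
  intro h0
  unfold discrim at h
  have key : (2 * A * x + B * y) ^ 2 + (4 * A * C - B ^ 2) * y ^ 2 = 0 := by
    linear_combination 4 * A * h0
  have hy : y = 0 := by
    by_contra hy
    nlinarith [sq_nonneg (2 * A * x + B * y), sq_pos_of_ne_zero hy,
      mul_pos (sub_pos.2 h) (sq_pos_of_ne_zero hy)]
  subst hy
  have hx : x ≠ 0 := by simpa using hxy
  have hA : A = 0 := by simpa [hx] using h0
  subst hA
  nlinarith [sq_nonneg B]

theorem ncard_directions_of_mul_quadratic_forms (A B C A' B' C' : ℝ)
    (h : discrim A B C < 0) (h' : 0 < discrim A' B' C') :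
    {θ : ℝ | θ ∈ Set.Ico 0 Real.pi ∧
      (A * Real.cos θ ^ 2 + B * Real.cos θ * Real.sin θ + C * Real.sin θ ^ 2) *
      (A' * Real.cos θ ^ 2 + B' * Real.cos θ * Real.sin θ + C' * Real.sin θ ^ 2) = 0}.ncard
      = 2 := by
  refine Eq.trans ?_ (ncard_directions_of_discrim_pos A' B' C' h')
  congr! 4 with θ
  refine mul_eq_zero_iff_left (quadratic_form_ne_zero_of_discrim_neg A B C _ _ h ?_)
  by_contra! hc
  have := Real.sin_sq_add_cos_sq θ
  simp [hc.1, hc.2] at this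

theorem hyperbolic_root_count_bcm16 (a d : ℝ)
    (P : ℝ → ℝ → ℝ)
    (hP : ∀ x y : ℝ, P x y = a*x^4 - 4*x^3*y + 4*x*y^3 + d*y^4)
    (Δ : ℝ) (hΔ : Δ = (a*d + 4)^3 - 27*(a + d)^2) :
    Δ < 0 →
      {θ : ℝ | θ ∈ Set.Ico 0 Real.pi ∧ P (Real.cos θ) (Real.sin θ) = 0}.ncard = 2 := by
  intro hneg
  obtain ⟨m, n, u, v, w, h4, h3, h2, h1, h0⟩ :=
    exists_quartic_factorization_s14 a (-4) 0 4 d (by norm_num)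
  have hfac : ∀ x y : ℝ, P x y =
      (1 * x ^ 2 + m * x * y + n * y ^ 2) * (u * x ^ 2 + v * x * y + w * y ^ 2) := by
    intro x y
    rw [hP]
    linear_combination (-x ^ 4) * h4 - x ^ 3 * y * h3 - x ^ 2 * y ^ 2 * h2 - x * y ^ 3 * h1 -
      y ^ 4 * h0
  have hdisc : 256 * Δ = discrim 1 m n * discrim u v w *
      ((w - n * u) ^ 2 - (v - m * u) * (m * w - n * v)) ^ 2 := by
    have hI : 12 * (a * d + 4) =
        12 * u * (n * w) - 3 * (v + m * u) * (m * w + n * v) + (w + m * v + n * u) ^ 2 := by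
      rw [h3, h2, h1, h0, h4]
      ring
    have hJ : -432 * (a + d) = 72 * u * (w + m * v + n * u) * (n * w) +
        9 * (v + m * u) * (w + m * v + n * u) * (m * w + n * v) - 27 * u * (m * w + n * v) ^ 2 -
        27 * (n * w) * (v + m * u) ^ 2 - 2 * (w + m * v + n * u) ^ 3 := by
      rw [h3, h2, h1, h0, h4]
      ring
    have hIJ : 256 * Δ = (4 * (12 * (a * d + 4)) ^ 3 - (-432 * (a + d)) ^ 2) / 27 := by
      rw [hΔ]
      ring
    rw [hIJ, hI, hJ]
    unfold discrim
    ring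
  have hlt : discrim 1 m n * discrim u v w < 0 := by
    by_contra! hc
    nlinarith [mul_nonneg hc (sq_nonneg ((w - n * u) ^ 2 - (v - m * u) * (m * w - n * v)))]
  simp only [hfac]
  rcases mul_neg_iff.1 hlt with ⟨hp, hn⟩ | ⟨hn, hp⟩
  · refine Eq.trans ?_ (ncard_directions_of_mul_quadratic_forms u v w 1 m n hn hp)
    congr! 5 with θ
    ring
  · exact ncard_directions_of_mul_quadratic_forms 1 m n u v w hn hp
end

section
/- Let a, d be real numbers with a > 0 and d > 0, and define q : ℝ → ℝ by q(X) = a·X⁴ + 4·X + d. Then q(X) > 0 for all X ∈ ℝ if and only if a·d³ > 27. Moreover, if a·d³ < 27, then q has exactly two real roots. -/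
/-- A quartic `a X⁴ + 4 X + d` with `a ≠ 0` cannot vanish at three distinct real points. -/
lemma eq_or_eq_of_quartic_roots {a d x y z : ℝ} (ha : a ≠ 0)
    (hx : a*x^4 + 4*x + d = 0) (hy : a*y^4 + 4*y + d = 0) (hz : a*z^4 + 4*z + d = 0)
    (hxy : x ≠ y) : z = x ∨ z = y := by
  by_contra! h
  obtain ⟨hzx, hzy⟩ := h
  have hxy' : a*(x^3 + x^2*y + x*y^2 + y^3) + 4 = 0 :=
    mul_left_cancel₀ (sub_ne_zero.mpr hxy) (by linear_combination hx - hy)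
  have hxz' : a*(x^3 + x^2*z + x*z^2 + z^3) + 4 = 0 :=
    mul_left_cancel₀ (sub_ne_zero.mpr hzx.symm) (by linear_combination hx - hz)
  have hsum : x^2 + y^2 + z^2 + x*y + y*z + z*x = 0 :=
    mul_left_cancel₀ (mul_ne_zero ha (sub_ne_zero.mpr hzy.symm))
      (by linear_combination hxy' - hxz')
  have hpos : 0 < (x - y)^2 := by
    have := sub_ne_zero.mpr hxy
    positivity
  nlinarith [sq_nonneg (x + y), sq_nonneg (y + z), sq_nonneg (z + x), sq_nonneg (x + y + z)]

lemma exists_pos_mul_cube_eq_one {a : ℝ} (ha : 0 < a) : ∃ t : ℝ, 0 < t ∧ a*t^3 = 1 := by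
  refine ⟨(a⁻¹) ^ ((3 : ℕ) : ℝ)⁻¹, by positivity, ?_⟩
  rw [Real.rpow_inv_natCast_pow (by positivity) (by norm_num), mul_inv_cancel₀ ha.ne']

theorem quartic_positivity_criterion (a d : ℝ) (ha : 0 < a) (hd : 0 < d)
    (q : ℝ → ℝ) (hq : ∀ X : ℝ, q X = a*X^4 + 4*X + d) :
    ((∀ X : ℝ, q X > 0) ↔ a*d^3 > 27) ∧
    (a*d^3 < 27 → {X : ℝ | q X = 0}.ncard = 2) := by
  obtain ⟨t, ht, hat⟩ := exists_pos_mul_cube_eq_one ha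
  have hfactor (X : ℝ) : q X = a*((X + t)^2*((X - t)^2 + 2*t^2)) + (d - 3*t) := by
    rw [hq]
    linear_combination (-4*X - 3*t)*hat
  have hcube : a*(3*t)^3 = 27 := by linear_combination 27*hat
  have hmin : q (-t) = d - 3*t := by
    rw [hfactor]
    ring
  refine ⟨⟨fun h => ?_, fun h X => ?_⟩, fun h => ?_⟩
  · have hlt : 3*t < d := by linarith [h (-t)]
    rw [gt_iff_lt, ← hcube]
    gcongr
  · have hlt : 3*t < d := by
      rw [gt_iff_lt, ← hcube] at h
      exact lt_of_pow_lt_pow_left₀ 3 hd.le (lt_of_mul_lt_mul_left h ha.le)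
    have hnonneg : 0 ≤ a*((X + t)^2*((X - t)^2 + 2*t^2)) := by positivity
    rw [hfactor]
    linarith
  · have hlt : d < 3*t := by
      rw [← hcube] at h
      exact lt_of_pow_lt_pow_left₀ 3 (by positivity) (lt_of_mul_lt_mul_left h ha.le)
    have hcont : Continuous q := by
      rw [funext hq]
      fun_prop
    have hneg : q (-t) < 0 := by linarith
    have hleft : 0 < q (-2*t) := by
      have : q (-2*t) = 8*t + d := by
        rw [hq]
        linear_combination 16*t*hat
      linarith
    have hright : 0 < q 0 := by simpa [hq] using hd
    obtain ⟨x, hx, hqx⟩ := intermediate_value_Ioo' (by linarith : -2*t ≤ -t)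
      hcont.continuousOn ⟨hneg, hleft⟩
    obtain ⟨y, hy, hqy⟩ := intermediate_value_Ioo (by linarith : -t ≤ 0)
      hcont.continuousOn ⟨hneg, hright⟩
    have hxy : x ≠ y := (hx.2.trans hy.1).ne
    rw [Set.ncard_eq_two]
    refine ⟨x, y, hxy, Set.ext fun z => ⟨fun hz => ?_, ?_⟩⟩
    · exact eq_or_eq_of_quartic_roots ha.ne' (hq x ▸ hqx) (hq y ▸ hqy) (hq z ▸ hz) hxy
    · rintro (rfl | rfl)
      exacts [hqx, hqy]
end

section
/- Let λ be a real number with 0 < λ < 1/2, and define Δ : ℝ → ℝ by Δ(t) = 1 + 3λ·sin t − 2λ·sin³t. Then: (i) Δ(t) > 0 for all t ∈ [−π/2, π/2]; (ii) for all t ∈ ℝ, Δ'(t)·(1 + λ·sin t) + 3λ·cos t·Δ(t) = 6λ·cos³t·(1 + 2λ·sin t); and (iii) the function g(t) = Δ(t)^{−1/3}/(1 + λ·sin t) is strictly decreasing on [−π/2, π/2]. -/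
/-- The cubic `Δ`, in the variable `s = sin t`, is positive on `[-1, 1]`. -/
theorem discriminant_cubic_pos {l s : ℝ} (hl0 : 0 < l) (hl : l < 1/2)
    (hs : s ∈ Set.Icc (-1 : ℝ) 1) : 0 < 1 + 3*l*s - 2*l*s^3 := by
  obtain ⟨hs1, hs2⟩ := hs
  have h : 0 ≤ 2 + 3*s - 2*s^3 := by
    nlinarith [mul_nonneg (sub_nonneg.2 hs2) (sq_nonneg (s + 1/2)), sq_nonneg (s + 1/2)]
  nlinarith [mul_nonneg hl0.le h]

/-- The polynomial `Δ · (1 + λ s)³`, whose power `-1/3` is `g`, is strictly increasing on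
`[-1, 1]`. -/
theorem strictMonoOn_discriminant_mul_cube {l : ℝ} (hl0 : 0 < l) (hl : l < 1/2) :
    StrictMonoOn (fun s : ℝ => (1 + 3*l*s - 2*l*s^3) * (1 + l*s)^3) (Set.Icc (-1) 1) := by
  refine strictMonoOn_of_deriv_pos (convex_Icc _ _) (by fun_prop) fun s hs => ?_
  rw [interior_Icc] at hs
  obtain ⟨hs1, hs2⟩ := hs
  have hd : HasDerivAt (fun s : ℝ => (1 + 3*l*s - 2*l*s^3) * (1 + l*s)^3)
      ((1 + l*s)^2 * (6*l*((1 - s)*(1 + s))*(1 + 2*l*s))) s := by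
    have h1 : HasDerivAt (fun s : ℝ => 1 + 3*l*s - 2*l*s^3) (3*l - 2*l*(3*s^2)) s := by
      refine ((((hasDerivAt_id s).const_mul (3*l)).const_add 1).sub
        ((hasDerivAt_pow 3 s).const_mul (2*l))).congr_deriv ?_
      norm_num
    have h2 : HasDerivAt (fun s : ℝ => 1 + l*s) l s := by
      simpa using ((hasDerivAt_id s).const_mul l).const_add 1
    refine (h1.mul (h2.pow 3)).congr_deriv ?_
    simp only [Pi.pow_apply]
    norm_num
    ring
  rw [hd.deriv]
  have h1 : 0 < 1 + 2*l*s := by nlinarith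
  have h2 : 0 < 1 + l*s := by nlinarith
  have h3 : 0 < 1 - s := by linarith
  have h4 : 0 < 1 + s := by linarith
  positivity

theorem rotation_example_two_quadratic_points
    (lam : ℝ) (hlam0 : 0 < lam) (hlam : lam < 1/2)
    (Δ : ℝ → ℝ) (hΔ : ∀ t, Δ t = 1 + 3*lam*Real.sin t - 2*lam*(Real.sin t)^3)
    (g : ℝ → ℝ) (hg : ∀ t, g t = (Δ t) ^ (-(1:ℝ)/3) / (1 + lam*Real.sin t)) :
    (∀ t ∈ Set.Icc (-(Real.pi/2)) (Real.pi/2), 0 < Δ t) ∧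
    (∀ t : ℝ, deriv Δ t * (1 + lam*Real.sin t) + 3*lam*Real.cos t * Δ t
        = 6*lam*(Real.cos t)^3*(1 + 2*lam*Real.sin t)) ∧
    StrictAntiOn g (Set.Icc (-(Real.pi/2)) (Real.pi/2)) := by
  have hpos : ∀ t, 0 < Δ t := fun t => by
    rw [hΔ]
    exact discriminant_cubic_pos hlam0 hlam (Real.sin_mem_Icc t)
  refine ⟨fun t _ => hpos t, fun t => ?_, fun a ha b hb hab => ?_⟩
  · have hd : HasDerivAt Δ
        (3*lam*Real.cos t - 2*lam*(3*(Real.sin t)^2*Real.cos t)) t := by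
      rw [funext hΔ]
      refine ((((Real.hasDerivAt_sin t).const_mul (3*lam)).const_add 1).sub
        (((Real.hasDerivAt_sin t).pow 3).const_mul (2*lam))).congr_deriv ?_
      norm_num
    rw [hd.deriv, hΔ, show Real.cos t ^ 3 = Real.cos t * (1 - Real.sin t ^ 2) by
      rw [← Real.cos_sq']; ring]
    ring
  · have hfac : ∀ t, 0 < 1 + lam*Real.sin t := fun t => by
      nlinarith [Real.neg_one_le_sin t]
    have hg' : ∀ t, g t = (Δ t * (1 + lam*Real.sin t)^3) ^ (-(1:ℝ)/3) := fun t => by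
      rw [hg, Real.mul_rpow (hpos t).le (pow_nonneg (hfac t).le 3), ← Real.rpow_natCast,
        ← Real.rpow_mul (hfac t).le, div_eq_mul_inv, ← Real.rpow_neg_one (1 + lam*Real.sin t)]
      norm_num
    rw [hg', hg']
    refine Real.rpow_lt_rpow_of_neg (mul_pos (hpos a) (pow_pos (hfac a) 3)) ?_ (by norm_num)
    rw [hΔ, hΔ]
    exact strictMonoOn_discriminant_mul_cube hlam0 hlam (Real.sin_mem_Icc a)
      (Real.sin_mem_Icc b) (Real.strictMonoOn_sin ha hb hab)
end
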